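/- arXiv:2103.06755 — 3 statements merged into one kernel-verified Lean document; each statement's English description precedes it below -/
import Mathlib

section
/- Let k:ℝⁿ∖{0}→ℝ be a kernel of class C² on ℝⁿ∖{0} and homogeneous of degree 1−n, i.e. k(λx) = λ^{1−n} k(x) for all λ>0 and x≠0. Let 0<γ<1 and f ∈ C^γ_c(ℝⁿ;ℝ), and set R = m(supp f)^{1/n} where m is Lebesgue measure. Then the convolution Tf(x) = ∫_{ℝⁿ} k(x−x') f(x') dx' satisfies ‖Tf‖_{L^∞} ≤ c R ‖f‖_{L^∞} for a constant c independent of f and R. -/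
open MeasureTheory ENNReal Metric Set

noncomputable section

abbrev Euc (n : ℕ) := EuclideanSpace ℝ (Fin n)

def supN {n : ℕ} (f : Euc n → ℝ) : ℝ≥0∞ := ⨆ x, ENNReal.ofReal |f x|

def hSemi {n : ℕ} (γ : ℝ) (f : Euc n → ℝ) : ℝ≥0∞ :=
  ⨆ (x : Euc n) (y : Euc n) (_ : x ≠ y), ENNReal.ofReal (|f x - f y| / ‖x - y‖ ^ γ)

def hNorm {n : ℕ} (γ : ℝ) (f : Euc n → ℝ) : ℝ≥0∞ := supN f + hSemi γ f

/-- `k` is (positively) homogeneous of degree `1 - n`. -/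
def Homog1n {n : ℕ} (k : Euc n → ℝ) : Prop :=
  ∀ c : ℝ, 0 < c → ∀ x : Euc n, x ≠ 0 → k (c • x) = c ^ ((1 : ℝ) - n) * k x

/-- A continuous kernel homogeneous of degree `1 - n` is dominated by a multiple of `|x|^(1-n)`. -/
lemma Homog1n.exists_abs_le {n : ℕ} (hn : 1 ≤ n) {k : Euc n → ℝ}
    (hk : ContinuousOn k {(0 : Euc n)}ᶜ) (hkh : Homog1n k) :
    ∃ M : ℝ, 0 < M ∧ ∀ x : Euc n, x ≠ 0 → |k x| ≤ M * (‖x‖ ^ (n - 1))⁻¹ := by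
  have hsub : sphere (0 : Euc n) 1 ⊆ {(0 : Euc n)}ᶜ := by
    intro x hx h0
    simp_all
  obtain ⟨M, hM⟩ := (isCompact_sphere (0 : Euc n) 1).exists_bound_of_continuousOn (hk.mono hsub)
  refine ⟨max M 1, by positivity, fun x hx => ?_⟩
  have hx' : 0 < ‖x‖ := norm_pos_iff.mpr hx
  set u : Euc n := ‖x‖⁻¹ • x
  have hu : ‖u‖ = 1 := norm_smul_inv_norm hx
  have hu0 : u ≠ 0 := norm_pos_iff.mp (by rw [hu]; exact one_pos)
  have hxu : x = ‖x‖ • u := (smul_inv_smul₀ hx'.ne' x).symm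
  have hpow : ‖x‖ ^ ((1 : ℝ) - n) = (‖x‖ ^ (n - 1))⁻¹ := by
    rw [← Real.rpow_natCast, ← Real.rpow_neg hx'.le, Nat.cast_sub hn]
    simp
  have hku : |k u| ≤ max M 1 := (hM u (by simpa using hu)).trans (le_max_left _ _)
  calc |k x| = |k (‖x‖ • u)| := by rw [← hxu]
    _ = |k u| * (‖x‖ ^ (n - 1))⁻¹ := by
      rw [hkh _ hx' u hu0, hpow, abs_mul, abs_of_nonneg (by positivity), mul_comm]
    _ ≤ _ := by gcongr

lemma setLIntegral_ball_inv_norm_pow {n : ℕ} (hn : 1 ≤ n) {r : ℝ} (hr : 0 ≤ r) :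
    ∫⁻ x in ball (0 : Euc n) r, ENNReal.ofReal (‖x‖ ^ (n - 1))⁻¹ =
      ENNReal.ofReal (n * volume.real (ball (0 : Euc n) 1) * r) := by
  have : Nonempty (Fin n) := ⟨⟨0, hn⟩⟩
  have hone : EqOn (fun y : ℝ => y ^ (n - 1) • (y ^ (n - 1))⁻¹) (fun _ => 1) (Ioo 0 r) :=
    fun y hy => mul_inv_cancel₀ (pow_pos hy.1 _).ne'
  have hint : IntegrableOn (fun x : Euc n => (‖x‖ ^ (n - 1))⁻¹) (ball 0 r) := by
    rw [integrableOn_fun_norm_addHaar volume (f := fun y : ℝ => (y ^ (n - 1))⁻¹),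
      finrank_euclideanSpace_fin, integrableOn_congr_fun hone measurableSet_Ioo]
    exact integrableOn_const (by simp)
  rw [← ofReal_integral_eq_lintegral_ofReal hint (.of_forall fun x => by positivity)]
  congr 1
  have hind : ∀ x : Euc n, (ball (0 : Euc n) r).indicator (fun x => (‖x‖ ^ (n - 1))⁻¹) x =
      (Iio r).indicator (fun y : ℝ => (y ^ (n - 1))⁻¹) ‖x‖ := by
    intro x
    simp [indicator]
  rw [← integral_indicator measurableSet_ball, integral_congr_ae (.of_forall hind),
    integral_fun_norm_addHaar volume, finrank_euclideanSpace_fin]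
  have hrad : ∫ y in Ioi (0 : ℝ), y ^ (n - 1) • (Iio r).indicator (fun y : ℝ => (y ^ (n - 1))⁻¹) y
      = r := by
    have : ∀ y : ℝ, y ^ (n - 1) • (Iio r).indicator (fun y : ℝ => (y ^ (n - 1))⁻¹) y =
        (Iio r).indicator (fun y : ℝ => y ^ (n - 1) • (y ^ (n - 1))⁻¹) y := by
      intro y
      by_cases h : y < r <;> simp [h]
    simp_rw [this]
    rw [setIntegral_indicator measurableSet_Iio, Ioi_inter_Iio,
      setIntegral_congr_fun measurableSet_Ioo hone]
    simp [hr]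
  rw [hrad]
  simp [mul_assoc]

/-- The Riesz potential of order one of a set is at most a multiple of its linear size. -/
lemma setLIntegral_inv_norm_sub_pow_le {n : ℕ} (hn : 1 ≤ n) (x : Euc n) {S : Set (Euc n)}
    (hS : volume S ≠ ⊤) :
    ∫⁻ y in S, ENNReal.ofReal (‖x - y‖ ^ (n - 1))⁻¹ ≤
      ENNReal.ofReal ((n * volume.real (ball (0 : Euc n) 1) + 1) *
        (volume S).toReal ^ ((1 : ℝ) / n)) := by
  by_cases h0 : volume S = 0
  · rw [Measure.restrict_eq_zero.mpr h0, lintegral_zero_measure]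
    exact zero_le
  have hm : 0 < (volume S).toReal := ENNReal.toReal_pos h0 hS
  set r : ℝ := (volume S).toReal ^ ((1 : ℝ) / n) with hr_def
  have hr : 0 < r := Real.rpow_pos_of_pos hm _
  have hrn : r ^ n = (volume S).toReal := by
    rw [hr_def, one_div, Real.rpow_inv_natCast_pow hm.le (by omega)]
  have hball : ∫⁻ y in ball x r, ENNReal.ofReal (‖x - y‖ ^ (n - 1))⁻¹ =
      ENNReal.ofReal (n * volume.real (ball (0 : Euc n) 1) * r) := by
    rw [← setLIntegral_ball_inv_norm_pow hn hr.le, ← lintegral_indicator measurableSet_ball,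
      ← lintegral_indicator measurableSet_ball, ← lintegral_sub_left_eq_self _ x]
    refine lintegral_congr fun y => ?_
    simp [indicator, dist_eq_norm]
  have hfar : ∫⁻ y in S \ ball x r, ENNReal.ofReal (‖x - y‖ ^ (n - 1))⁻¹ ≤ ENNReal.ofReal r :=
    calc ∫⁻ y in S \ ball x r, ENNReal.ofReal (‖x - y‖ ^ (n - 1))⁻¹
        ≤ ∫⁻ _ in S \ ball x r, ENNReal.ofReal (r ^ (n - 1))⁻¹ := by
          rw [sdiff_eq, inter_comm, ← Measure.restrict_restrict measurableSet_ball.compl]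
          refine setLIntegral_mono' measurableSet_ball.compl fun y hy => ?_
          have hy' : r ≤ ‖x - y‖ := by
            rw [← dist_eq_norm, dist_comm]
            simpa using hy
          gcongr
      _ ≤ ENNReal.ofReal (r ^ (n - 1))⁻¹ * volume S := by
          rw [setLIntegral_const]
          gcongr
          exact sdiff_subset
      _ = ENNReal.ofReal r := by
          rw [← ENNReal.ofReal_toReal hS, ← hrn, ← ENNReal.ofReal_mul (by positivity)]
          congr 1
          obtain ⟨m, rfl⟩ : ∃ m, n = m + 1 := ⟨n - 1, by omega⟩
          rw [Nat.add_sub_cancel, pow_succ, inv_mul_cancel_left₀ (by positivity)]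
  calc ∫⁻ y in S, ENNReal.ofReal (‖x - y‖ ^ (n - 1))⁻¹
      ≤ ∫⁻ y in ball x r ∪ S \ ball x r, ENNReal.ofReal (‖x - y‖ ^ (n - 1))⁻¹ :=
        lintegral_mono_set (by rw [union_sdiff_self]; exact subset_union_right)
    _ ≤ _ := lintegral_union_le _ _ _
    _ ≤ ENNReal.ofReal (n * volume.real (ball (0 : Euc n) 1) * r) + ENNReal.ofReal r :=
        add_le_add hball.le hfar
    _ = _ := by
        rw [← ENNReal.ofReal_add (by positivity) hr.le]
        ring_nf

lemma enorm_le_supN {n : ℕ} (f : Euc n → ℝ) (x : Euc n) : ‖f x‖ₑ ≤ supN f := by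
  rw [Real.enorm_eq_ofReal_abs]
  exact le_iSup (fun x => ENNReal.ofReal |f x|) x

lemma ofReal_abs_integral_mul_le {n : ℕ} {f g : Euc n → ℝ} (hf : supN f ≠ ⊤) :
    ENNReal.ofReal |∫ y, g y * f y| ≤ (∫⁻ y in tsupport f, ‖g y‖ₑ) * supN f := by
  rw [← Real.enorm_eq_ofReal_abs, ← lintegral_mul_const' _ _ hf,
    ← setIntegral_eq_integral_of_forall_compl_eq_zero (s := tsupport f)
      fun y hy => by rw [image_eq_zero_of_notMem_tsupport hy, mul_zero]]
  refine (enorm_integral_le_lintegral_enorm _).trans (lintegral_mono fun y => ?_)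
  rw [enorm_mul]
  gcongr
  exact enorm_le_supN f y

theorem stmt3 (n : ℕ) (γ : ℝ) (hγ0 : 0 < γ) (hγ1 : γ < 1)
    (k : Euc n → ℝ) (hk : ContDiffOn ℝ 2 k {(0 : Euc n)}ᶜ) (hkh : Homog1n k) :
    ∃ c : ℝ, 0 < c ∧
      ∀ f : Euc n → ℝ, hNorm γ f ≠ ⊤ → HasCompactSupport f →
        supN (fun x => ∫ y, k (x - y) * f y) ≤
          ENNReal.ofReal (c * (volume (tsupport f)).toReal ^ ((1 : ℝ) / n)) * supN f := by
  rcases Nat.eq_zero_or_pos n with rfl | hn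
  · refine ⟨|k 0| * volume.real (univ : Set (Euc 0)) + 1, by positivity, fun f hf _ => ?_⟩
    refine iSup_le fun x => (ofReal_abs_integral_mul_le (ENNReal.add_ne_top.mp hf).1).trans ?_
    gcongr
    have hfin : volume (univ : Set (Euc 0)) ≠ ⊤ := (subsingleton_univ.isCompact).measure_ne_top
    calc ∫⁻ y in tsupport f, ‖k (x - y)‖ₑ ≤ ∫⁻ _ : Euc 0, ENNReal.ofReal |k 0| := by
          refine (setLIntegral_le_lintegral _ _).trans (lintegral_mono fun y => ?_)
          rw [Subsingleton.elim (x - y) 0, Real.enorm_eq_ofReal_abs]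
      _ = ENNReal.ofReal (|k 0| * volume.real (univ : Set (Euc 0))) := by
          rw [lintegral_const, ENNReal.ofReal_mul (abs_nonneg _), ofReal_measureReal hfin]
      _ ≤ _ := ENNReal.ofReal_le_ofReal (by simp)
  · have : Nonempty (Fin n) := ⟨⟨0, hn⟩⟩
    obtain ⟨M, hM0, hM⟩ := Homog1n.exists_abs_le hn hk.continuousOn hkh
    refine ⟨M * (n * volume.real (ball (0 : Euc n) 1) + 1), by positivity, fun f hf hfc => ?_⟩
    refine iSup_le fun x => (ofReal_abs_integral_mul_le (ENNReal.add_ne_top.mp hf).1).trans ?_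
    gcongr
    rw [mul_assoc, ENNReal.ofReal_mul hM0.le]
    calc ∫⁻ y in tsupport f, ‖k (x - y)‖ₑ
        ≤ ∫⁻ y in tsupport f, ENNReal.ofReal M * ENNReal.ofReal (‖x - y‖ ^ (n - 1))⁻¹ := by
          refine lintegral_mono_ae (ae_restrict_of_ae ?_)
          filter_upwards [Measure.ae_ne volume x] with y hy
          rw [← ENNReal.ofReal_mul hM0.le, Real.enorm_eq_ofReal_abs]
          exact ENNReal.ofReal_le_ofReal (hM _ (sub_ne_zero.mpr hy.symm))
      _ ≤ _ := by
          rw [lintegral_const_mul' _ _ ENNReal.ofReal_ne_top]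
          gcongr
          exact setLIntegral_inv_norm_sub_pow_le hn x hfc.isCompact.measure_ne_top

end
end

section
/- Let k:ℝⁿ∖{0}→ℝ be a kernel of class C² on ℝⁿ∖{0} and homogeneous of degree 1−n, and let P = ∂_i k for some i ∈ {1,…,n}. Let 0<γ<1 and f ∈ C^γ_c(ℝⁿ;ℝ), with R = m(supp f)^{1/n}. Then the principal value operator Sf(x) = lim_{δ→0} ∫_{|x−x'|>δ} P(x−x') f(x') dx' satisfies, for every ε>0, ‖Sf‖_{L^∞} ≤ c { |f|_γ ε^γ + max(1, ln(R/ε)) ‖f‖_{L^∞} } for a constant c independent of f, R, ε. -/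
open MeasureTheory ENNReal Metric Set

noncomputable section

/-- partial derivative in the `j`-th coordinate direction -/
def pd {n : ℕ} (j : Fin n) (f : Euc n → ℝ) (x : Euc n) : ℝ :=
  fderiv ℝ f x (EuclideanSpace.single j 1)
theorem pd_smul_of_homog1n {n : ℕ} {k : Euc n → ℝ} (hk : ContDiffOn ℝ 2 k {(0 : Euc n)}ᶜ)
    (hkh : Homog1n k) (i : Fin n) {c : ℝ} (hc : 0 < c) {x : Euc n} (hx : x ≠ 0) :
    pd i k (c • x) = c ^ (-(n : ℝ)) * pd i k x := by
  have hdiff : ∀ y : Euc n, y ≠ 0 → DifferentiableAt ℝ k y := fun y hy =>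
    (hk.differentiableOn (by norm_num)).differentiableAt (isOpen_compl_singleton.mem_nhds hy)
  have hcx : c • x ≠ 0 := smul_ne_zero hc.ne' hx
  have h1 : HasFDerivAt (fun y : Euc n => k (c • y))
      ((fderiv ℝ k (c • x)).comp (c • ContinuousLinearMap.id ℝ (Euc n))) x :=
    (hdiff _ hcx).hasFDerivAt.comp x ((hasFDerivAt_id x).const_smul c)
  have h2 : HasFDerivAt (fun y : Euc n => k (c • y))
      (c ^ ((1 : ℝ) - n) • fderiv ℝ k x) x := by
    refine ((hdiff x hx).hasFDerivAt.const_mul (c ^ ((1 : ℝ) - n))).congr_of_eventuallyEq ?_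
    filter_upwards [isOpen_compl_singleton.mem_nhds hx] with y hy
    exact hkh c hc y hy
  have h3 := congrArg (fun A : Euc n →L[ℝ] ℝ => A (EuclideanSpace.single i 1)) (h1.unique h2)
  simp only [ContinuousLinearMap.comp_apply, smul_apply,
    ContinuousLinearMap.id_apply, map_smul, smul_eq_mul] at h3
  have h4 : c ^ ((1 : ℝ) - n) = c * c ^ (-(n : ℝ)) := by
    rw [sub_eq_add_neg, Real.rpow_add hc, Real.rpow_one]
  rw [h4, mul_assoc] at h3
  exact mul_left_cancel₀ hc.ne' h3

theorem pd_eq_mul_rpow_norm {n : ℕ} {k : Euc n → ℝ} (hk : ContDiffOn ℝ 2 k {(0 : Euc n)}ᶜ)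
    (hkh : Homog1n k) (i : Fin n) {x : Euc n} (hx : x ≠ 0) :
    pd i k x = pd i k (‖x‖⁻¹ • x) * ‖x‖ ^ (-(n : ℝ)) := by
  have hx' : 0 < ‖x‖ := norm_pos_iff.2 hx
  have h := pd_smul_of_homog1n hk hkh i hx' (x := ‖x‖⁻¹ • x) (smul_ne_zero (inv_ne_zero hx'.ne') hx)
  rw [smul_inv_smul₀ hx'.ne'] at h
  rw [h, mul_comm]

theorem continuousOn_pd {n : ℕ} {k : Euc n → ℝ} (hk : ContDiffOn ℝ 2 k {(0 : Euc n)}ᶜ)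
    (i : Fin n) : ContinuousOn (pd i k) {(0 : Euc n)}ᶜ :=
  (hk.continuousOn_fderiv_of_isOpen isOpen_compl_singleton (by norm_num)).clm_apply
    continuousOn_const

theorem exists_abs_pd_le {n : ℕ} {k : Euc n → ℝ} (hk : ContDiffOn ℝ 2 k {(0 : Euc n)}ᶜ)
    (hkh : Homog1n k) (i : Fin n) :
    ∃ C : ℝ, 0 ≤ C ∧ ∀ x : Euc n, x ≠ 0 → |pd i k x| ≤ C * ‖x‖ ^ (-(n : ℝ)) := by
  have hsub : sphere (0 : Euc n) 1 ⊆ {(0 : Euc n)}ᶜ := fun y hy h0 => by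
    rw [mem_singleton_iff.1 h0] at hy
    simp at hy
  obtain ⟨C, hC⟩ := (isCompact_sphere (0 : Euc n) 1).exists_bound_of_continuousOn
    ((continuousOn_pd hk i).mono hsub)
  refine ⟨max C 0, le_max_right _ _, fun x hx => ?_⟩
  have hx' : 0 < ‖x‖ := norm_pos_iff.2 hx
  rw [pd_eq_mul_rpow_norm hk hkh i hx, abs_mul, abs_of_nonneg (Real.rpow_nonneg hx'.le _)]
  have := hC (‖x‖⁻¹ • x) (by simp [norm_smul, hx'.ne'])
  rw [Real.norm_eq_abs] at this
  gcongr
  exact this.trans (le_max_left _ _)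

/-- Integration in polar coordinates of a product of an angular and a radial function. -/
theorem integral_eq_integral_toSphere_mul_integral_Ioi {n : ℕ} {F h : Euc n → ℝ} {g : ℝ → ℝ}
    (hn : 0 < n) (hF : ∀ x : Euc n, x ≠ 0 → F x = h (‖x‖⁻¹ • x) * g ‖x‖) :
    ∫ x, F x = (∫ ω : sphere (0 : Euc n) 1, h ω ∂(volume : Measure (Euc n)).toSphere) *
      ∫ r in Ioi (0 : ℝ), r ^ (n - 1) * g r := by
  have : Nonempty (Fin n) := ⟨⟨0, hn⟩⟩
  have hdim : Module.finrank ℝ (Euc n) = n := by simp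
  calc
    ∫ x, F x = ∫ x : ({(0 : Euc n)}ᶜ : Set (Euc n)), F x ∂(volume.comap Subtype.val) := by
      rw [integral_subtype_comap (measurableSet_singleton _).compl F, restrict_compl_singleton]
    _ = ∫ p : sphere (0 : Euc n) 1 × Ioi (0 : ℝ), h p.1 * g p.2
          ∂((volume : Measure (Euc n)).toSphere.prod (.volumeIoiPow (n - 1))) := by
      have := (volume : Measure (Euc n)).measurePreserving_homeomorphUnitSphereProd.integral_comp
        (Homeomorph.measurableEmbedding _)
        (fun p : sphere (0 : Euc n) 1 × Ioi (0 : ℝ) => h p.1 * g p.2)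
      rw [hdim] at this
      rw [← this]
      refine integral_congr_ae (.of_forall fun x => ?_)
      simpa using hF x x.2
    _ = (∫ ω : sphere (0 : Euc n) 1, h ω ∂(volume : Measure (Euc n)).toSphere) *
          ∫ r : Ioi (0 : ℝ), g r ∂(Measure.volumeIoiPow (n - 1)) :=
      integral_prod_mul (fun ω : sphere (0 : Euc n) 1 => h ω) (fun r : Ioi (0 : ℝ) => g r)
    _ = _ := by
      congr 1
      simp only [Measure.volumeIoiPow, ENNReal.ofReal]
      rw [integral_withDensity_eq_integral_smul,
        integral_subtype_comap measurableSet_Ioi fun a ↦ Real.toNNReal (a ^ (n - 1)) • g a,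
        setIntegral_congr_fun measurableSet_Ioi fun x hx ↦ ?_]
      · rw [NNReal.smul_def, Real.coe_toNNReal _ (pow_nonneg (le_of_lt hx) _), smul_eq_mul]
      · exact (measurable_subtype_coe.pow_const _).real_toNNReal

theorem pow_pred_mul_rpow {n : ℕ} (hn : 0 < n) {r : ℝ} (hr : 0 < r) (s : ℝ) :
    r ^ (n - 1) * r ^ (s - n) = r ^ (s - 1) := by
  rw [← Real.rpow_natCast, ← Real.rpow_add hr, Nat.cast_pred hn]
  congr 1
  ring

theorem measurableSet_annulus {n : ℕ} (a b : ℝ) :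
    MeasurableSet {z : Euc n | a < ‖z‖ ∧ ‖z‖ ≤ b} :=
  (measurableSet_lt measurable_const measurable_norm).inter
    (measurableSet_le measurable_norm measurable_const)

theorem isCompact_closed_annulus {n : ℕ} (a b : ℝ) :
    IsCompact {z : Euc n | a ≤ ‖z‖ ∧ ‖z‖ ≤ b} :=
  (isCompact_closedBall (0 : Euc n) b).of_isClosed_subset
    ((isClosed_le continuous_const continuous_norm).inter
      (isClosed_le continuous_norm continuous_const)) fun z hz => by simpa using hz.2

theorem integrableOn_annulus_rpow_norm {n : ℕ} {a : ℝ} (b s : ℝ) (ha : 0 < a) :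
    IntegrableOn (fun z : Euc n => ‖z‖ ^ s) {z : Euc n | a < ‖z‖ ∧ ‖z‖ ≤ b} := by
  have hc : ContinuousOn (fun z : Euc n => ‖z‖ ^ s) {z : Euc n | a ≤ ‖z‖ ∧ ‖z‖ ≤ b} := by
    intro z hz
    exact (continuous_norm.continuousAt.rpow_const
      (Or.inl (ha.trans_le hz.1).ne')).continuousWithinAt
  exact (hc.integrableOn_compact (isCompact_closed_annulus a b)).mono_set
    fun z hz => ⟨hz.1.le, hz.2⟩

theorem integral_annulus_rpow_norm {n : ℕ} (hn : 0 < n) {a b : ℝ} (s : ℝ) (ha : 0 < a)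
    (hab : a ≤ b) :
    ∫ z in {z : Euc n | a < ‖z‖ ∧ ‖z‖ ≤ b}, ‖z‖ ^ (s - n) =
      n * volume.real (ball (0 : Euc n) 1) * ∫ r in a..b, r ^ (s - 1) := by
  rw [← integral_indicator (measurableSet_annulus a b),
    integral_eq_integral_toSphere_mul_integral_Ioi (h := fun _ => 1)
      (g := (Ioc a b).indicator fun r => r ^ (s - n)) hn
      (fun z _ => by rw [one_mul]; rfl)]
  congr 1
  · simp [Measure.toSphere_real_apply_univ]
  · have : ∀ r ∈ Ioi (0 : ℝ), r ^ (n - 1) * (Ioc a b).indicator (fun r => r ^ (s - n)) r =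
        (Ioc a b).indicator (fun r => r ^ (s - 1)) r := by
      intro r hr
      by_cases h : r ∈ Ioc a b
      · simp only [indicator_of_mem h]
        exact pow_pred_mul_rpow hn hr s
      · simp [indicator_of_notMem h]
    rw [setIntegral_congr_fun measurableSet_Ioi this, setIntegral_indicator measurableSet_Ioc,
      intervalIntegral.integral_of_le hab,
      inter_eq_right.2 (show Ioc a b ⊆ Ioi 0 from fun r hr => ha.trans hr.1)]

theorem integral_toSphere_pd_eq_zero {n : ℕ} {k : Euc n → ℝ}
    (hk : ContDiffOn ℝ 2 k {(0 : Euc n)}ᶜ) (hkh : Homog1n k) (i : Fin n) :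
    ∫ ω : sphere (0 : Euc n) 1, pd i k ω ∂(volume : Measure (Euc n)).toSphere = 0 := by
  have hn : 0 < n := i.pos
  set v : Euc n := EuclideanSpace.single i 1 with hv
  let b : ContDiffBump (3 : ℝ) := ⟨1, 2, one_pos, one_lt_two⟩
  have hbd : ContDiff ℝ 1 b := b.contDiff
  have hb0 : ∀ y, b y ≠ 0 → 1 ≤ y ∧ y ≤ 5 := fun y hy => by
    have : y ∈ Function.support b := hy
    rw [b.support_eq, mem_ball, Real.dist_eq, abs_lt] at this
    change _ < y - 3 ∧ y - 3 < 2 at this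
    constructor <;> linarith [this.1, this.2, show b.rOut = 2 from rfl]
  have hb'0 : ∀ y, deriv b y ≠ 0 → 1 ≤ y ∧ y ≤ 5 := fun y hy => by
    have : y ∈ tsupport b := support_deriv_subset hy
    rw [b.tsupport_eq, mem_closedBall, Real.dist_eq, abs_le] at this
    constructor <;> linarith [this.1, this.2, show b.rOut = 2 from rfl]
  have hnorm : ∀ x : Euc n, 1 ≤ ‖x‖ ^ 2 ∧ ‖x‖ ^ 2 ≤ 5 → x ∈ {z : Euc n | 1 ≤ ‖z‖ ∧ ‖z‖ ≤ 3} :=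
    fun x hx => ⟨by nlinarith [norm_nonneg x, hx.1], by nlinarith [norm_nonneg x, hx.2]⟩
  set K : Set (Euc n) := {z : Euc n | 1 ≤ ‖z‖ ∧ ‖z‖ ≤ 3} with hK
  have hKc : IsCompact K := isCompact_closed_annulus 1 3
  have hK0 : K ⊆ {(0 : Euc n)}ᶜ := fun x hx h0 => by
    rw [mem_singleton_iff.1 h0] at hx
    exact absurd hx.1 (by simp)
  have hint : ∀ F : Euc n → ℝ, ContinuousOn F K → Function.support F ⊆ K → Integrable F :=
    fun F hF hs => (integrableOn_iff_integrable_of_support_subset hs).1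
      (hF.integrableOn_compact hKc)
  let g : Euc n → ℝ := fun x => b (‖x‖ ^ 2)
  have hg : ∀ x, HasFDerivAt g (deriv b (‖x‖ ^ 2) • (2 • innerSL ℝ x)) x := fun x =>
    ((hbd.differentiable (by norm_num)) _).hasDerivAt.comp_hasFDerivAt x
      (hasStrictFDerivAt_norm_sq x).hasFDerivAt
  have hgv : ∀ x, fderiv ℝ g x v = deriv b (‖x‖ ^ 2) * (2 * inner ℝ x v) := fun x => by
    rw [(hg x).fderiv]
    simp
  have hgc : Continuous g := b.continuous.comp (by fun_prop)
  have hg'c : Continuous fun x => fderiv ℝ g x v := by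
    simp only [hgv]
    have : Continuous (deriv b) := hbd.continuous_deriv le_rfl
    fun_prop
  have hgs : Function.support g ⊆ K := fun x hx => hnorm x (hb0 _ hx)
  have hgts : tsupport g ⊆ K := closure_minimal hgs hKc.isClosed
  have hparts := integral_mul_fderiv_eq_neg_fderiv_mul_of_integrable (μ := volume) (f := k)
    (g := g) (v := v)
    (hint _ (((continuousOn_pd hk i).mono hK0).mul hgc.continuousOn)
      fun x hx => hgs (right_ne_zero_of_mul hx))
    (hint _ ((hk.continuousOn.mono hK0).mul hg'c.continuousOn) fun x hx => by
      have := right_ne_zero_of_mul hx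
      rw [hgv] at this
      exact hnorm x (hb'0 _ (left_ne_zero_of_mul this)))
    (hint _ ((hk.continuousOn.mono hK0).mul hgc.continuousOn)
      fun x hx => hgs (right_ne_zero_of_mul hx))
    (fun x hx => (hk.differentiableOn (by norm_num)).differentiableAt
      (isOpen_compl_singleton.mem_nhds (hK0 (hgts hx))))
    (fun x _ => (hg x).differentiableAt)
  have hleft : ∫ x, k x * fderiv ℝ g x v = 0 := by
    rw [integral_eq_integral_toSphere_mul_integral_Ioi (h := fun x => k x * inner ℝ x v)
      (g := fun r => r ^ ((1 : ℝ) - n) * (deriv b (r ^ 2) * (2 * r))) hn]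
    · refine mul_eq_zero_of_right _ ?_
      have h1 : ∀ r ∈ Ioi (0 : ℝ), r ^ (n - 1) * (r ^ ((1 : ℝ) - n) * (deriv b (r ^ 2) * (2 * r))) =
          deriv b (r ^ 2) * (2 * r) := fun r hr => by
        rw [← mul_assoc, pow_pred_mul_rpow hn hr]
        simp
      have hd : ∀ r : ℝ, HasDerivAt (fun r => b (r ^ 2)) (deriv b (r ^ 2) * (2 * r)) r := fun r => by
        have := ((hbd.differentiable (by norm_num)) (r ^ 2)).hasDerivAt.comp r (hasDerivAt_pow 2 r)
        simpa [Function.comp_def] using this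
      have hc : Continuous fun r : ℝ => deriv b (r ^ 2) * (2 * r) := by
        have : Continuous (deriv b) := hbd.continuous_deriv le_rfl
        fun_prop
      rw [setIntegral_congr_fun measurableSet_Ioi h1,
        setIntegral_eq_of_subset_of_forall_sdiff_eq_zero (s := Ioc 0 3) measurableSet_Ioi
          (fun r hr => hr.1), ← intervalIntegral.integral_of_le (by norm_num),
        intervalIntegral.integral_eq_sub_of_hasDerivAt (fun r _ => hd r)
          (hc.intervalIntegrable _ _)]
      · have e1 : b ((3 : ℝ) ^ 2) = 0 := by
          by_contra h
          linarith [(hb0 _ h).2]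
        have e2 : b ((0 : ℝ) ^ 2) = 0 := by
          by_contra h
          linarith [(hb0 _ h).1]
        rw [e1, e2, sub_zero]
      · intro r hr
        have hr3 : 3 < r := by
          by_contra h
          exact hr.2 ⟨hr.1, not_lt.1 h⟩
        refine mul_eq_zero_of_left ?_ _
        by_contra h
        nlinarith [(hb'0 _ h).2]
    · intro x hx
      have hx' : 0 < ‖x‖ := norm_pos_iff.2 hx
      have hkx := hkh ‖x‖ hx' (‖x‖⁻¹ • x) (smul_ne_zero (inv_ne_zero hx'.ne') hx)
      rw [smul_inv_smul₀ hx'.ne'] at hkx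
      rw [hgv, hkx, inner_smul_left]
      simp only [RCLike.conj_to_real]
      field_simp
  rw [hleft, zero_eq_neg] at hparts
  change ∫ x, pd i k x * g x = 0 at hparts
  rw [integral_eq_integral_toSphere_mul_integral_Ioi (h := pd i k)
    (g := fun r => r ^ (-(n : ℝ)) * b (r ^ 2)) hn] at hparts
  · refine (mul_eq_zero.1 hparts).resolve_right (ne_of_gt ?_)
    have h1 : ∀ r ∈ Ioi (0 : ℝ), r ^ (n - 1) * (r ^ (-(n : ℝ)) * b (r ^ 2)) =
        r ^ (-1 : ℝ) * b (r ^ 2) := fun r hr => by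
      have := pow_pred_mul_rpow hn hr 0
      rw [zero_sub, zero_sub] at this
      rw [← mul_assoc, this]
    rw [setIntegral_congr_fun measurableSet_Ioi h1]
    have hz : ∀ r ∈ Ioi (0 : ℝ) \ Icc 1 3, r ^ (-1 : ℝ) * b (r ^ 2) = 0 := fun r hr => by
      refine mul_eq_zero_of_right _ ?_
      by_contra h
      have h0 : 0 < r := hr.1
      exact hr.2 ⟨by nlinarith [(hb0 _ h).1], by nlinarith [(hb0 _ h).2]⟩
    rw [setIntegral_eq_of_subset_of_forall_sdiff_eq_zero (s := Icc 1 3) measurableSet_Ioi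
      (fun r hr => one_pos.trans_le hr.1) hz, integral_Icc_eq_integral_Ioc,
      ← intervalIntegral.integral_of_le (by norm_num)]
    refine intervalIntegral.integral_pos (by norm_num) ?_ (fun r hr => ?_) ⟨Real.sqrt 3, ?_, ?_⟩
    · intro r hr
      have hr0 : r ≠ 0 := (one_pos.trans_le hr.1).ne'
      exact ((Real.continuousAt_rpow_const r _ (Or.inl hr0)).mul
        (b.continuous.comp (continuous_pow 2)).continuousAt).continuousWithinAt
    · exact mul_nonneg (Real.rpow_nonneg (one_pos.trans hr.1).le _) b.nonneg
    · constructor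
      · exact Real.le_sqrt_of_sq_le (by norm_num)
      · exact Real.sqrt_le_iff.2 ⟨by norm_num, by norm_num⟩
    · rw [Real.sq_sqrt (by norm_num)]
      exact mul_pos (Real.rpow_pos_of_pos (by positivity) _)
        (b.pos_of_mem_ball (mem_ball_self b.rOut_pos))
  · intro x hx
    rw [pd_eq_mul_rpow_norm hk hkh i hx, mul_assoc]

theorem setIntegral_annulus_pd_eq_zero {n : ℕ} {k : Euc n → ℝ}
    (hk : ContDiffOn ℝ 2 k {(0 : Euc n)}ᶜ) (hkh : Homog1n k) (i : Fin n) (a b : ℝ) :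
    ∫ z in {z : Euc n | a < ‖z‖ ∧ ‖z‖ ≤ b}, pd i k z = 0 := by
  rw [← integral_indicator (measurableSet_annulus a b),
    integral_eq_integral_toSphere_mul_integral_Ioi (h := pd i k)
      (g := (Ioc a b).indicator fun r => r ^ (-(n : ℝ))) i.pos,
    integral_toSphere_pd_eq_zero hk hkh i, zero_mul]
  intro x hx
  by_cases h : a < ‖x‖ ∧ ‖x‖ ≤ b
  · rw [indicator_of_mem (show x ∈ {z : Euc n | a < ‖z‖ ∧ ‖z‖ ≤ b} from h),
      indicator_of_mem (show ‖x‖ ∈ Ioc a b from h), pd_eq_mul_rpow_norm hk hkh i hx]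
  · rw [indicator_of_notMem (show x ∉ {z : Euc n | a < ‖z‖ ∧ ‖z‖ ≤ b} from h),
      indicator_of_notMem (show ‖x‖ ∉ Ioc a b from h), mul_zero]

theorem abs_setIntegral_annulus_pd_mul_le {n : ℕ} {k : Euc n → ℝ}
    (hk : ContDiffOn ℝ 2 k {(0 : Euc n)}ᶜ) (hkh : Homog1n k) (i : Fin n) {C : ℝ} (hC0 : 0 ≤ C)
    (hC : ∀ x : Euc n, x ≠ 0 → |pd i k x| ≤ C * ‖x‖ ^ (-(n : ℝ))) {γ : ℝ} (hγ : 0 < γ)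
    {g : Euc n → ℝ} (hg : Continuous g) {H : ℝ} (hH0 : 0 ≤ H)
    (hH : ∀ z, |g z - g 0| ≤ H * ‖z‖ ^ γ) {δ ε : ℝ} (hδ : 0 < δ) (hδε : δ ≤ ε) :
    |∫ z in {z : Euc n | δ < ‖z‖ ∧ ‖z‖ ≤ ε}, pd i k z * g z| ≤
      C * H * (n * volume.real (ball (0 : Euc n) 1) * (ε ^ γ / γ)) := by
  have hpos : ∀ z ∈ {z : Euc n | δ < ‖z‖ ∧ ‖z‖ ≤ ε}, 0 < ‖z‖ := fun z hz => hδ.trans hz.1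
  have hcont : ContinuousOn (pd i k) {z : Euc n | δ ≤ ‖z‖ ∧ ‖z‖ ≤ ε} :=
    (continuousOn_pd hk i).mono fun z hz h0 => by
      have h1 : δ ≤ ‖z‖ := hz.1
      rw [mem_singleton_iff.1 h0, norm_zero] at h1
      exact hδ.not_ge h1
  have hsub : {z : Euc n | δ < ‖z‖ ∧ ‖z‖ ≤ ε} ⊆ {z : Euc n | δ ≤ ‖z‖ ∧ ‖z‖ ≤ ε} :=
    fun z hz => ⟨hz.1.le, hz.2⟩
  have hint : ∀ h : Euc n → ℝ, Continuous h →
      IntegrableOn (fun z => pd i k z * h z) {z : Euc n | δ < ‖z‖ ∧ ‖z‖ ≤ ε} := fun h hh =>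
    ((hcont.mul hh.continuousOn).integrableOn_compact (isCompact_closed_annulus δ ε)).mono_set hsub
  have heq : ∫ z in {z : Euc n | δ < ‖z‖ ∧ ‖z‖ ≤ ε}, pd i k z * g z =
      ∫ z in {z : Euc n | δ < ‖z‖ ∧ ‖z‖ ≤ ε}, pd i k z * (g z - g 0) := by
    simp only [mul_sub]
    rw [integral_sub (hint _ hg) (hint _ continuous_const), integral_mul_const,
      setIntegral_annulus_pd_eq_zero hk hkh i, zero_mul, sub_zero]
  have hbound : |∫ z in {z : Euc n | δ < ‖z‖ ∧ ‖z‖ ≤ ε}, pd i k z * (g z - g 0)| ≤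
      ∫ z in {z : Euc n | δ < ‖z‖ ∧ ‖z‖ ≤ ε}, C * H * ‖z‖ ^ (γ - n) := by
    rw [← Real.norm_eq_abs]
    refine norm_integral_le_of_norm_le ((integrableOn_annulus_rpow_norm ε _ hδ).const_mul _) ?_
    filter_upwards [ae_restrict_mem (measurableSet_annulus δ ε)] with z hz
    have hz0 := hpos z hz
    rw [norm_mul, Real.norm_eq_abs, Real.norm_eq_abs]
    calc |pd i k z| * |g z - g 0| ≤ (C * ‖z‖ ^ (-(n : ℝ))) * (H * ‖z‖ ^ γ) := by
          gcongr
          · exact hC z (norm_pos_iff.1 hz0)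
          · exact hH z
      _ = C * H * ‖z‖ ^ (γ - n) := by
          rw [sub_eq_add_neg, Real.rpow_add hz0]
          ring
  rw [heq]
  refine hbound.trans ?_
  rw [integral_const_mul, integral_annulus_rpow_norm i.pos γ hδ hδε,
    integral_rpow (Or.inl (by linarith)), sub_add_cancel]
  gcongr
  exact sub_le_self _ (Real.rpow_nonneg hδ.le _)

theorem abs_setIntegral_annulus_pd_mul_le_log {n : ℕ} {k : Euc n → ℝ} (i : Fin n) {C : ℝ}
    (hC0 : 0 ≤ C) (hC : ∀ x : Euc n, x ≠ 0 → |pd i k x| ≤ C * ‖x‖ ^ (-(n : ℝ)))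
    {g : Euc n → ℝ} {M : ℝ} (hM : ∀ z, |g z| ≤ M) {ε L : ℝ} (hε : 0 < ε) (hεL : ε ≤ L) :
    |∫ z in {z : Euc n | ε < ‖z‖ ∧ ‖z‖ ≤ L}, pd i k z * g z| ≤
      C * M * (n * volume.real (ball (0 : Euc n) 1) * Real.log (L / ε)) := by
  have hbound : |∫ z in {z : Euc n | ε < ‖z‖ ∧ ‖z‖ ≤ L}, pd i k z * g z| ≤
      ∫ z in {z : Euc n | ε < ‖z‖ ∧ ‖z‖ ≤ L}, C * M * ‖z‖ ^ ((0 : ℝ) - n) := by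
    rw [← Real.norm_eq_abs]
    refine norm_integral_le_of_norm_le ((integrableOn_annulus_rpow_norm L _ hε).const_mul _) ?_
    filter_upwards [ae_restrict_mem (measurableSet_annulus ε L)] with z hz
    have hz0 : 0 < ‖z‖ := hε.trans hz.1
    rw [norm_mul, Real.norm_eq_abs, Real.norm_eq_abs]
    calc |pd i k z| * |g z| ≤ (C * ‖z‖ ^ (-(n : ℝ))) * M := by
          gcongr
          · exact hC z (norm_pos_iff.1 hz0)
          · exact hM z
      _ = C * M * ‖z‖ ^ ((0 : ℝ) - n) := by
          rw [zero_sub]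
          ring
  refine hbound.trans_eq ?_
  rw [integral_const_mul, integral_annulus_rpow_norm i.pos 0 hε hεL]
  simp only [zero_sub, Real.rpow_neg_one]
  rw [integral_inv_of_pos hε (hε.trans_le hεL)]

theorem abs_setIntegral_compl_closedBall_pd_mul_le {n : ℕ} {k : Euc n → ℝ} (i : Fin n) {C : ℝ}
    (hC0 : 0 ≤ C) (hC : ∀ x : Euc n, x ≠ 0 → |pd i k x| ≤ C * ‖x‖ ^ (-(n : ℝ)))
    {g : Euc n → ℝ} {T : Set (Euc n)} (hT : IsCompact T) (hgT : ∀ z, z ∉ T → g z = 0)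
    {M : ℝ} (hM : ∀ z, |g z| ≤ M) {L : ℝ} (hL : 0 < L) :
    |∫ z in {z : Euc n | L < ‖z‖}, pd i k z * g z| ≤
      C * M * (L ^ (-(n : ℝ)) * volume.real T) := by
  have hM0 : 0 ≤ M := (abs_nonneg _).trans (hM 0)
  have hmeas : MeasurableSet {z : Euc n | L < ‖z‖} :=
    measurableSet_lt measurable_const measurable_norm
  rw [setIntegral_eq_of_subset_of_forall_sdiff_eq_zero (s := {z : Euc n | L < ‖z‖} ∩ T) hmeas
    inter_subset_left, ← Real.norm_eq_abs]
  · have hfin : volume ({z : Euc n | L < ‖z‖} ∩ T) < ⊤ :=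
      (measure_mono inter_subset_right).trans_lt hT.measure_lt_top
    refine (norm_setIntegral_le_of_norm_le_const (C := C * M * L ^ (-(n : ℝ))) hfin ?_).trans ?_
    · intro z hz
      have hz1 : L < ‖z‖ := hz.1
      have hz0 : 0 < ‖z‖ := hL.trans hz1
      rw [norm_mul, Real.norm_eq_abs, Real.norm_eq_abs]
      calc |pd i k z| * |g z| ≤ (C * ‖z‖ ^ (-(n : ℝ))) * M := by
            gcongr
            · exact hC z (norm_pos_iff.1 hz0)
            · exact hM z
        _ ≤ (C * L ^ (-(n : ℝ))) * M := by
            have := Real.rpow_le_rpow_of_nonpos hL hz1.le (neg_nonpos.2 (Nat.cast_nonneg n))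
            gcongr
        _ = C * M * L ^ (-(n : ℝ)) := by ring
    · rw [mul_assoc (C * M)]
      have : volume.real ({z : Euc n | L < ‖z‖} ∩ T) ≤ volume.real T :=
        measureReal_mono inter_subset_right hT.measure_lt_top.ne
      gcongr
  · intro z hz
    rw [hgT z fun h => hz.2 ⟨hz.1, h⟩, mul_zero]

theorem integrableOn_compl_closedBall_pd_mul {n : ℕ} {k : Euc n → ℝ}
    (hk : ContDiffOn ℝ 2 k {(0 : Euc n)}ᶜ) (i : Fin n) {g : Euc n → ℝ} (hg : Continuous g)
    {T : Set (Euc n)} (hT : IsCompact T) (hgT : ∀ z, z ∉ T → g z = 0) {δ : ℝ} (hδ : 0 < δ) :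
    IntegrableOn (fun z => pd i k z * g z) {z : Euc n | δ < ‖z‖} := by
  have hcl : IsClosed {z : Euc n | δ ≤ ‖z‖} := isClosed_le continuous_const continuous_norm
  have hcont : ContinuousOn (fun z => pd i k z * g z) (T ∩ {z : Euc n | δ ≤ ‖z‖}) :=
    ((continuousOn_pd hk i).mono fun z hz h0 => by
      have h1 : δ ≤ ‖z‖ := hz.2
      rw [mem_singleton_iff.1 h0, norm_zero] at h1
      exact hδ.not_ge h1).mul hg.continuousOn
  have h := (hcont.integrableOn_compact (μ := volume) (hT.inter_right hcl)).mono_set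
    (show T ∩ {z : Euc n | δ < ‖z‖} ⊆ _ from fun z hz => ⟨hz.1, show δ ≤ ‖z‖ from le_of_lt hz.2⟩)
  refine h.of_forall_sdiff_eq_zero (measurableSet_lt measurable_const measurable_norm) ?_
  intro z hz
  rw [hgT z fun h => hz.2 ⟨h, hz.1⟩, mul_zero]

theorem abs_truncated_integral_le {n : ℕ} {k : Euc n → ℝ}
    (hk : ContDiffOn ℝ 2 k {(0 : Euc n)}ᶜ) (hkh : Homog1n k) (i : Fin n) {C : ℝ} (hC0 : 0 ≤ C)
    (hC : ∀ x : Euc n, x ≠ 0 → |pd i k x| ≤ C * ‖x‖ ^ (-(n : ℝ))) {γ : ℝ} (hγ : 0 < γ)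
    {g : Euc n → ℝ} (hg : Continuous g) {T : Set (Euc n)} (hT : IsCompact T)
    (hgT : ∀ z, z ∉ T → g z = 0) {H M : ℝ} (hH0 : 0 ≤ H)
    (hH : ∀ z, |g z - g 0| ≤ H * ‖z‖ ^ γ) (hM : ∀ z, |g z| ≤ M) {δ ε : ℝ} (hδ : 0 < δ)
    (hδε : δ ≤ ε) :
    |∫ z in {z : Euc n | δ < ‖z‖}, pd i k z * g z| ≤
      C * H * (n * volume.real (ball (0 : Euc n) 1) * (ε ^ γ / γ)) +
      C * M * ((n * volume.real (ball (0 : Euc n) 1) + 1) *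
        max 1 (Real.log (volume.real T ^ ((1 : ℝ) / n) / ε))) := by
  have hε : 0 < ε := hδ.trans_le hδε
  have hn : (n : ℝ) ≠ 0 := Nat.cast_ne_zero.2 i.pos.ne'
  have hM0 : 0 ≤ M := (abs_nonneg _).trans (hM 0)
  set R : ℝ := volume.real T ^ ((1 : ℝ) / n) with hR
  have hR0 : 0 ≤ R := Real.rpow_nonneg measureReal_nonneg _
  set D : ℝ := n * volume.real (ball (0 : Euc n) 1) with hD
  have hD0 : 0 ≤ D := by positivity
  set L : ℝ := max ε R with hL
  have hεL : ε ≤ L := le_max_left _ _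
  have hL0 : 0 < L := hε.trans_le hεL
  have hint := integrableOn_compl_closedBall_pd_mul hk i hg hT hgT hδ
  have hsplit : ∀ a b : ℝ, δ ≤ a → a ≤ b → ∫ z in {z : Euc n | a < ‖z‖}, pd i k z * g z =
      (∫ z in {z : Euc n | a < ‖z‖ ∧ ‖z‖ ≤ b}, pd i k z * g z) +
        ∫ z in {z : Euc n | b < ‖z‖}, pd i k z * g z := by
    intro a b hδa hab
    rw [← setIntegral_union _ (measurableSet_lt measurable_const measurable_norm)
      (hint.mono_set fun z hz => hδa.trans_lt hz.1)
      (hint.mono_set fun z hz => (hδa.trans hab).trans_lt hz)]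
    · congr 2
      ext z
      constructor
      · intro (hz : a < ‖z‖)
        exact (le_or_gt ‖z‖ b).imp (fun h => ⟨hz, h⟩) id
      · rintro (hz | hz)
        · exact hz.1
        · exact hab.trans_lt hz
    · exact disjoint_left.2 fun z hz hz' => hz.2.not_gt hz'
  have hvol : L ^ (-(n : ℝ)) * volume.real T ≤ 1 := by
    have h1 : volume.real T = R ^ (n : ℝ) := by
      rw [hR, ← Real.rpow_mul measureReal_nonneg, one_div, inv_mul_cancel₀ hn, Real.rpow_one]
    have h2 : R ^ (n : ℝ) ≤ L ^ (n : ℝ) :=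
      Real.rpow_le_rpow hR0 (le_max_right _ _) (Nat.cast_nonneg n)
    rw [h1, Real.rpow_neg hL0.le, inv_mul_eq_div]
    exact div_le_one_of_le₀ h2 (Real.rpow_nonneg hL0.le _)
  have hlog : Real.log (L / ε) ≤ max 1 (Real.log (R / ε)) := by
    rcases le_total R ε with h | h
    · rw [hL, max_eq_left h, div_self hε.ne', Real.log_one]
      exact zero_le_one.trans (le_max_left _ _)
    · rw [hL, max_eq_right h]
      exact le_max_right _ _
  have hmax : (1 : ℝ) ≤ max 1 (Real.log (R / ε)) := le_max_left _ _
  rw [hsplit δ ε le_rfl hδε, hsplit ε L hδε hεL]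
  refine (abs_add_le _ _).trans (add_le_add
    (abs_setIntegral_annulus_pd_mul_le hk hkh i hC0 hC hγ hg hH0 hH hδ hδε) ?_)
  refine (abs_add_le _ _).trans ((add_le_add
    (abs_setIntegral_annulus_pd_mul_le_log i hC0 hC hM hε hεL)
    (abs_setIntegral_compl_closedBall_pd_mul_le i hC0 hC hT hgT hM hL0)).trans ?_)
  rw [← mul_add, add_mul, one_mul]
  have hvol' := hvol.trans hmax
  gcongr

theorem abs_le_toReal_supN {n : ℕ} {f : Euc n → ℝ} (hf : supN f ≠ ⊤) (x : Euc n) :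
    |f x| ≤ (supN f).toReal :=
  (ENNReal.ofReal_le_iff_le_toReal hf).1 (le_iSup (fun x => ENNReal.ofReal |f x|) x)

theorem abs_sub_le_toReal_hSemi {n : ℕ} {γ : ℝ} {f : Euc n → ℝ}
    (hf : hSemi γ f ≠ ⊤) (x y : Euc n) : |f x - f y| ≤ (hSemi γ f).toReal * ‖x - y‖ ^ γ := by
  rcases eq_or_ne x y with rfl | hxy
  · rw [sub_self, abs_zero]
    positivity
  · have h : ENNReal.ofReal (|f x - f y| / ‖x - y‖ ^ γ) ≤ hSemi γ f :=
      le_iSup_of_le x (le_iSup_of_le y (le_iSup_of_le hxy le_rfl))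
    exact (div_le_iff₀ (Real.rpow_pos_of_pos (norm_pos_iff.2 (sub_ne_zero.2 hxy)) _)).1
      ((ENNReal.ofReal_le_iff_le_toReal hf).1 h)

theorem continuous_of_hSemi_ne_top {n : ℕ} {γ : ℝ} (hγ : 0 < γ) {f : Euc n → ℝ}
    (hf : hSemi γ f ≠ ⊤) : Continuous f := by
  refine continuous_iff_continuousAt.2 fun x => tendsto_iff_dist_tendsto_zero.2 ?_
  refine squeeze_zero (fun _ => dist_nonneg) (fun y => ?_)
    (g := fun y => (hSemi γ f).toReal * ‖y - x‖ ^ γ) ?_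
  · rw [Real.dist_eq]
    exact abs_sub_le_toReal_hSemi hf y x
  · have : Continuous fun y : Euc n => (hSemi γ f).toReal * ‖y - x‖ ^ γ :=
      continuous_const.mul ((continuous_id.sub continuous_const).norm.rpow_const
        fun _ => Or.inr hγ.le)
    simpa [Real.zero_rpow hγ.ne'] using this.tendsto x

theorem setIntegral_pd_sub_mul_eq {n : ℕ} (k f : Euc n → ℝ) (i : Fin n) (x : Euc n) (δ : ℝ) :
    ∫ y in {y : Euc n | δ < ‖x - y‖}, pd i k (x - y) * f y =
      ∫ z in {z : Euc n | δ < ‖z‖}, pd i k z * f (x - z) := by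
  rw [← integral_indicator (measurableSet_lt measurable_const (by fun_prop)),
    ← integral_indicator (measurableSet_lt measurable_const measurable_norm),
    ← integral_sub_left_eq_self _ volume x]
  refine integral_congr_ae (.of_forall fun y => ?_)
  simp [indicator_apply]

theorem stmt4 (n : ℕ) (γ : ℝ) (hγ0 : 0 < γ) (hγ1 : γ < 1)
    (k : Euc n → ℝ) (hk : ContDiffOn ℝ 2 k {(0 : Euc n)}ᶜ) (hkh : Homog1n k) (i : Fin n) :
    ∃ c : ℝ, 0 < c ∧
      ∀ f : Euc n → ℝ, hNorm γ f ≠ ⊤ → HasCompactSupport f →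
      ∀ S : Euc n → ℝ,
        (∀ x : Euc n, Filter.Tendsto
            (fun δ : ℝ => ∫ y in {y : Euc n | δ < ‖x - y‖}, pd i k (x - y) * f y)
            (nhdsWithin 0 (Set.Ioi 0)) (nhds (S x))) →
        ∀ ε : ℝ, 0 < ε →
          supN S ≤ ENNReal.ofReal c *
            (hSemi γ f * ENNReal.ofReal (ε ^ γ) +
              ENNReal.ofReal
                (max 1 (Real.log ((volume (tsupport f)).toReal ^ ((1 : ℝ) / n) / ε))) *
                supN f) := by
  obtain ⟨C, hC0, hC⟩ := exists_abs_pd_le hk hkh i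
  set D : ℝ := n * volume.real (ball (0 : Euc n) 1) with hD
  have hD0 : 0 ≤ D := by positivity
  refine ⟨C * (D / γ) + C * (D + 1) + 1, by positivity, ?_⟩
  intro f hf hfc S hS ε hε
  have hsup : supN f ≠ ⊤ := fun h => hf (by rw [hNorm, h, top_add])
  have hsemi : hSemi γ f ≠ ⊤ := fun h => hf (by rw [hNorm, h, add_top])
  have hfcont := continuous_of_hSemi_ne_top hγ0 hsemi
  set H := (hSemi γ f).toReal with hH
  set M := (supN f).toReal with hM
  have hH0 : 0 ≤ H := ENNReal.toReal_nonneg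
  have hM0 : 0 ≤ M := ENNReal.toReal_nonneg
  set m : ℝ := max 1 (Real.log ((volume (tsupport f)).toReal ^ ((1 : ℝ) / n) / ε)) with hm
  have hm0 : 0 ≤ m := zero_le_one.trans (le_max_left _ _)
  have hεγ : 0 ≤ ε ^ γ := Real.rpow_nonneg hε.le _
  refine iSup_le fun x => ?_
  have hmp : MeasurePreserving (fun z : Euc n => x - z) :=
    Measure.measurePreserving_sub_left volume x
  have hvol : volume.real ((fun z => x - z) ⁻¹' tsupport f) = (volume (tsupport f)).toReal :=
    congrArg ENNReal.toReal
      (hmp.measure_preimage (isClosed_tsupport f).measurableSet.nullMeasurableSet)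
  have hle : |S x| ≤ C * H * (D * (ε ^ γ / γ)) + C * M * ((D + 1) * m) := by
    refine le_of_tendsto (hS x).abs ?_
    filter_upwards [Ioc_mem_nhdsGT hε] with δ hδ
    rw [setIntegral_pd_sub_mul_eq, hm, ← hvol]
    refine abs_truncated_integral_le hk hkh i hC0 hC hγ0 (g := fun z => f (x - z))
      (hfcont.comp (continuous_const.sub continuous_id))
      ((Homeomorph.subLeft x).isCompact_preimage.2 hfc)
      (fun z hz => image_eq_zero_of_notMem_tsupport hz) hH0 (fun z => ?_)
      (fun z => abs_le_toReal_supN hsup _) hδ.1 hδ.2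
    simpa using abs_sub_le_toReal_hSemi hsemi (x - z) (x - 0)
  rw [← ENNReal.ofReal_toReal hsemi, ← ENNReal.ofReal_toReal hsup, ← ENNReal.ofReal_mul hH0,
    ← ENNReal.ofReal_mul hm0, ← ENNReal.ofReal_add (by positivity) (by positivity),
    ← ENNReal.ofReal_mul (by positivity)]
  refine ENNReal.ofReal_le_ofReal (hle.trans ?_)
  have e1 : C * H * (D * (ε ^ γ / γ)) = C * (D / γ) * (H * ε ^ γ) := by ring
  have e2 : C * M * ((D + 1) * m) = C * (D + 1) * (m * M) := by ring
  have p1 : 0 ≤ C * (D / γ) := by positivity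
  have p2 : 0 ≤ C * (D + 1) := by positivity
  have p3 : 0 ≤ H * ε ^ γ := by positivity
  have p4 : 0 ≤ m * M := by positivity
  rw [e1, e2]
  nlinarith [mul_nonneg p1 p4, mul_nonneg p2 p3]

end
end

section
/- Let k:ℝⁿ∖{0}→ℝ be a kernel of class C² on ℝⁿ∖{0} and homogeneous of degree 1−n, and let P = ∂_i k for some i ∈ {1,…,n}. Let 0<γ<1 and f ∈ C^γ_c(ℝⁿ;ℝ). Then the principal value operator Sf(x) = lim_{δ→0} ∫_{|x−x'|>δ} P(x−x') f(x') dx' satisfies the Hölder seminorm bound |Sf|_γ ≤ c |f|_γ for a constant c independent of f. -/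
open MeasureTheory ENNReal Metric Set

noncomputable section

theorem pd_smul {n : ℕ} {k : Euc n → ℝ} (hkh : Homog1n k) (i : Fin n) {c : ℝ} (hc : 0 < c)
    {x : Euc n} (hx : x ≠ 0) : pd i k (c • x) = (c ^ n)⁻¹ * pd i k x := by
  have h1 : (fun y => k (c • y)) =ᶠ[nhds x] fun y => c ^ ((1 : ℝ) - n) • k y := by
    filter_upwards [isOpen_ne.mem_nhds hx] with y hy using by simpa using hkh c hc y hy
  have h2 := h1.fderiv_eq (𝕜 := ℝ)
  rw [fderiv_comp_smul, show (fun y => c ^ ((1 : ℝ) - n) • k y) = c ^ ((1 : ℝ) - n) • k from rfl,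
    fderiv_const_smul_field] at h2
  have h3 := congrArg (fun L : Euc n →L[ℝ] ℝ => L (EuclideanSpace.single i 1)) h2
  simp only [smul_apply, smul_eq_mul, Pi.smul_apply] at h3
  rw [Real.rpow_sub hc, Real.rpow_one, Real.rpow_natCast] at h3
  unfold pd
  have : c * fderiv ℝ k (c • x) (EuclideanSpace.single i 1)
      = c * ((c ^ n)⁻¹ * fderiv ℝ k x (EuclideanSpace.single i 1)) := by
    rw [h3]; ring
  exact mul_left_cancel₀ hc.ne' this

/-- Polar coordinates for the product of a homogeneous function and a radial function. -/
theorem integral_homogeneous_mul_radial {n : ℕ} [NeZero n] {g : Euc n → ℝ} {φ : ℝ → ℝ}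
    (hg : ∀ c : ℝ, 0 < c → ∀ x : Euc n, x ≠ 0 → g (c • x) = φ c * g x) (ψ : ℝ → ℝ) :
    ∫ x, g x * ψ ‖x‖ = (∫ s : sphere (0 : Euc n) 1, g s ∂(volume : Measure (Euc n)).toSphere) *
      ∫ r in Ioi (0 : ℝ), r ^ (n - 1) * (φ r * ψ r) := by
  have : Nontrivial (Euc n) := by
    have : Nonempty (Fin n) := ⟨0⟩
    infer_instance
  set μ : Measure (Euc n) := volume
  calc
    ∫ x, g x * ψ ‖x‖ ∂μ
      = ∫ x : ({(0)}ᶜ : Set (Euc n)), g x.1 * ψ ‖x.1‖ ∂(μ.comap (↑)) := by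
      rw [integral_subtype_comap (measurableSet_singleton _).compl fun x ↦ g x * ψ ‖x‖,
        restrict_compl_singleton]
    _ = ∫ p : sphere (0 : Euc n) 1 × Ioi (0 : ℝ), g p.1 * (φ p.2 * ψ p.2)
          ∂(μ.toSphere.prod (Measure.volumeIoiPow (n - 1))) := by
      have h := μ.measurePreserving_homeomorphUnitSphereProd.integral_comp
        (Homeomorph.measurableEmbedding _)
        (fun p : sphere (0 : Euc n) 1 × Ioi (0 : ℝ) => g p.1 * (φ p.2 * ψ p.2))
      rw [finrank_euclideanSpace_fin] at h
      rw [← h]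
      congr 1 with x
      have hx : x.1 ≠ 0 := x.2
      have hx' : 0 < ‖x.1‖ := norm_pos_iff.2 hx
      have := hg ‖x.1‖ hx' (‖x.1‖⁻¹ • x.1) (by simp [hx])
      rw [smul_smul, mul_inv_cancel₀ hx'.ne', one_smul] at this
      simp only [homeomorphUnitSphereProd_apply_fst_coe, homeomorphUnitSphereProd_apply_snd_coe]
      rw [this]; ring
    _ = (∫ s, g s ∂μ.toSphere) *
          ∫ r : Ioi (0 : ℝ), φ r * ψ r ∂(Measure.volumeIoiPow (n - 1)) :=
      integral_prod_mul (fun s : sphere (0 : Euc n) 1 => g s) (fun r : Ioi (0 : ℝ) => φ r * ψ r)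
    _ = _ := by
      congr 1
      rw [Measure.volumeIoiPow, integral_withDensity_eq_integral_toReal_smul (by fun_prop) (by simp),
        integral_subtype_comap measurableSet_Ioi
          fun a ↦ (ENNReal.ofReal (a ^ (n - 1))).toReal • (φ a * ψ a)]
      refine setIntegral_congr_fun measurableSet_Ioi fun r hr => ?_
      have hr : 0 < r := hr
      simp (disch := positivity) [ENNReal.toReal_ofReal]

theorem integrable_mul_radial {n : ℕ} {g : Euc n → ℝ} (hg : ContinuousOn g {(0 : Euc n)}ᶜ)
    {ψ : ℝ → ℝ} (hψ : Continuous ψ) {a b : ℝ} (ha : 0 < a)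
    (hs : Function.support ψ ⊆ Icc a b) : Integrable fun x : Euc n => g x * ψ ‖x‖ := by
  have hK : IsCompact ((fun x : Euc n => ‖x‖) ⁻¹' Icc a b) := by
    refine (isCompact_closedBall (0 : Euc n) b).of_isClosed_subset
      (isClosed_Icc.preimage continuous_norm) fun x hx => by simpa using hx.2
  refine (integrableOn_iff_integrable_of_support_subset
    (s := (fun x : Euc n => ‖x‖) ⁻¹' Icc a b) ?_).1 (ContinuousOn.integrableOn_compact hK ?_)
  · exact fun x hx => hs (right_ne_zero_of_mul hx)
  · refine (hg.mono ?_).mul (hψ.comp continuous_norm).continuousOn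
    rintro x hx rfl
    simp only [mem_preimage, norm_zero, mem_Icc] at hx
    linarith [hx.1]

theorem integral_fderiv_apply_eq_zero {n : ℕ} {u : Euc n → ℝ} (hu : ContDiff ℝ 1 u)
    (hc : HasCompactSupport u) (v : Euc n) : ∫ x, fderiv ℝ u x v = 0 := by
  have h1 : Integrable fun x => fderiv ℝ u x v := by
    refine Continuous.integrable_of_hasCompactSupport ?_ (hc.fderiv_apply ℝ v)
    exact (hu.continuous_fderiv one_ne_zero).clm_apply continuous_const
  have h := integral_mul_fderiv_eq_neg_fderiv_mul_of_integrable (μ := volume)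
    (f := fun _ : Euc n => (1 : ℝ)) (g := u) (v := v) (by simp) (by simpa using h1)
    (by simpa using hu.continuous.integrable_of_hasCompactSupport hc)
    (fun x _ => by fun_prop) (fun x _ => hu.differentiable one_ne_zero x)
  simpa using h

theorem contDiffOn_pd {n : ℕ} {k : Euc n → ℝ} (hk : ContDiffOn ℝ 2 k {(0 : Euc n)}ᶜ)
    (i : Fin n) : ContDiffOn ℝ 1 (pd i k) {(0 : Euc n)}ᶜ :=
  (hk.fderiv_of_isOpen isOpen_compl_singleton (by norm_num)).clm_apply contDiffOn_const

theorem pd_mul_radial {n : ℕ} {k : Euc n → ℝ} (hk : ContDiffOn ℝ 2 k {(0 : Euc n)}ᶜ)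
    (i : Fin n) {ψ : ℝ → ℝ} (hψ : ContDiff ℝ 1 ψ) {x : Euc n} (hx : x ≠ 0) :
    fderiv ℝ (fun y => k y * ψ ‖y‖) x (EuclideanSpace.single i 1) =
      pd i k x * ψ ‖x‖ + k x * x i * ‖x‖⁻¹ * deriv ψ ‖x‖ := by
  have hkx : HasFDerivAt k (fderiv ℝ k x) x :=
    ((hk.contDiffAt (isOpen_compl_singleton.mem_nhds hx)).differentiableAt
      (by norm_num)).hasFDerivAt
  have hn : HasFDerivAt (fun y : Euc n => ‖y‖) (‖x‖⁻¹ • innerSL ℝ x) x := by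
    have h := (hasStrictFDerivAt_norm_sq x).hasFDerivAt.sqrt (by simpa using hx)
    simp only [Real.sqrt_sq (norm_nonneg _)] at h
    have hx' : ‖x‖ ≠ 0 := by simpa using hx
    have he : (1 / (2 * ‖x‖)) • (2 : ℕ) • innerSL ℝ x = ‖x‖⁻¹ • innerSL ℝ x := by
      ext y
      simp
      field_simp
    rwa [he] at h
  have hψx : HasFDerivAt (fun y : Euc n => ψ ‖y‖) (deriv ψ ‖x‖ • (‖x‖⁻¹ • innerSL ℝ x)) x :=
    (hψ.differentiable one_ne_zero ‖x‖).hasDerivAt.comp_hasFDerivAt x hn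
  rw [(hkx.fun_mul hψx).fderiv]
  simp [pd, EuclideanSpace.inner_single_right]
  ring

theorem contDiff_mul_radial {n : ℕ} {k : Euc n → ℝ} (hk : ContDiffOn ℝ 2 k {(0 : Euc n)}ᶜ)
    {ψ : ℝ → ℝ} (hψ : ContDiff ℝ 1 ψ) {a b : ℝ} (ha : 0 < a)
    (hs : Function.support ψ ⊆ Icc a b) : ContDiff ℝ 1 fun x : Euc n => k x * ψ ‖x‖ := by
  refine contDiff_iff_contDiffAt.2 fun x => ?_
  by_cases hx : x = 0
  · subst hx
    refine (contDiffAt_const (c := (0 : ℝ))).congr_of_eventuallyEq ?_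
    filter_upwards [ball_mem_nhds (0 : Euc n) ha] with y hy
    have : ψ ‖y‖ = 0 := by
      by_contra h
      have := (hs h).1
      simp at hy
      linarith
    simp [this]
  · exact ((hk.contDiffAt (isOpen_compl_singleton.mem_nhds hx)).of_le (by norm_num)).mul
      (hψ.contDiffAt.comp x (contDiffAt_norm ℝ hx))

theorem hasCompactSupport_mul_radial {n : ℕ} (k : Euc n → ℝ)
    {ψ : ℝ → ℝ} {a b : ℝ} (hs : Function.support ψ ⊆ Icc a b) :
    HasCompactSupport fun x : Euc n => k x * ψ ‖x‖ := by
  refine HasCompactSupport.of_support_subset_isCompact (isCompact_closedBall (0 : Euc n) b) ?_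
  intro x hx
  simpa using (hs (right_ne_zero_of_mul hx)).2

/-- A partial derivative of a kernel of degree `1 - n` has mean zero against radial weights. -/
theorem integral_pd_mul_radial {n : ℕ} {k : Euc n → ℝ}
    (hk : ContDiffOn ℝ 2 k {(0 : Euc n)}ᶜ) (hkh : Homog1n k) (i : Fin n) (ψ : ℝ → ℝ) :
    ∫ x, pd i k x * ψ ‖x‖ = 0 := by
  have : NeZero n := ⟨by rintro rfl; exact i.elim0⟩
  have hP : ∀ c : ℝ, 0 < c → ∀ x : Euc n, x ≠ 0 → pd i k (c • x) = (c ^ n)⁻¹ * pd i k x :=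
    fun c hc x hx => pd_smul hkh i hc hx
  rw [integral_homogeneous_mul_radial hP, mul_eq_zero]
  left
  let b : ContDiffBump (2 : ℝ) := ⟨1 / 2, 1, by norm_num, by norm_num⟩
  have hb : ContDiff ℝ 1 b := b.contDiff
  have hbs : Function.support b ⊆ Icc 1 3 := by
    rw [b.support_eq, Real.ball_eq_Ioo]
    exact fun x hx => ⟨by linarith [hx.1], by linarith [hx.2]⟩
  have hbd : Function.support (deriv b) ⊆ Icc 1 3 :=
    (support_deriv_subset).trans (closure_minimal hbs isClosed_Icc)
  have hdc : Continuous (deriv b) := hb.continuous_deriv le_rfl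
  have hg : ∀ c : ℝ, 0 < c → ∀ x : Euc n, x ≠ 0 →
      (fun x : Euc n => k x * x i * ‖x‖⁻¹) (c • x) =
        c ^ ((1 : ℝ) - n) * (fun x : Euc n => k x * x i * ‖x‖⁻¹) x := by
    intro c hc x hx
    have : ‖x‖ ≠ 0 := by simpa using hx
    simp only [hkh c hc x hx, norm_smul, Real.norm_of_nonneg hc.le, PiLp.smul_apply, smul_eq_mul]
    field_simp
  have hgc : ContinuousOn (fun x : Euc n => k x * x i * ‖x‖⁻¹) {(0 : Euc n)}ᶜ := by
    refine (hk.continuousOn.mul (by fun_prop)).mul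
      (continuous_norm.continuousOn.inv₀ fun x hx => by simpa using hx)
  have hI := integral_fderiv_apply_eq_zero (contDiff_mul_radial hk hb one_pos hbs)
    (hasCompactSupport_mul_radial k hbs) (EuclideanSpace.single i 1)
  have hne : ∀ᵐ x : Euc n, x ≠ 0 := by simp [ae_iff]
  rw [integral_congr_ae (hne.mono fun x hx => pd_mul_radial hk i hb hx),
    integral_add (integrable_mul_radial (contDiffOn_pd hk i).continuousOn b.continuous
      one_pos hbs) (integrable_mul_radial hgc hdc one_pos hbd),
    integral_homogeneous_mul_radial hP, integral_homogeneous_mul_radial hg] at hI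
  have hz : ∫ r in Ioi (0 : ℝ), r ^ (n - 1) * (r ^ ((1 : ℝ) - n) * deriv b r) = 0 := by
    have h1 : ∫ r in Ioi (0 : ℝ), r ^ (n - 1) * (r ^ ((1 : ℝ) - n) * deriv b r)
        = ∫ r in Ioi (0 : ℝ), deriv b r := by
      refine setIntegral_congr_fun measurableSet_Ioi fun r (hr : 0 < r) => ?_
      have : (r : ℝ) ^ (n - 1) * r ^ ((1 : ℝ) - n) = 1 := by
        rw [← Real.rpow_natCast, ← Real.rpow_add hr, Nat.cast_sub NeZero.one_le]
        simp
      simp only [← mul_assoc, this, one_mul]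
    rw [h1, setIntegral_eq_integral_of_forall_compl_eq_zero]
    · exact integral_eq_zero_of_hasDerivAt_of_integrable
        (fun x => (hb.differentiable one_ne_zero x).hasDerivAt)
        (hdc.integrable_of_hasCompactSupport b.hasCompactSupport.deriv)
        (b.continuous.integrable_of_hasCompactSupport b.hasCompactSupport)
    · intro x hx
      by_contra h
      have := (hbd h).1
      simp at hx
      linarith
  rw [hz, mul_zero, add_zero, mul_eq_zero] at hI
  refine hI.resolve_right (ne_of_gt ?_)
  have h1 : ∀ r ∈ Ioi (0 : ℝ), r ^ (n - 1) * ((r ^ n)⁻¹ * b r) = r⁻¹ * b r := by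
    intro r (hr : 0 < r)
    have : r ^ n = r ^ (n - 1) * r := by rw [← pow_succ, Nat.sub_add_cancel NeZero.one_le]
    rw [this]; field_simp
  rw [setIntegral_congr_fun measurableSet_Ioi h1, setIntegral_eq_integral_of_forall_compl_eq_zero]
  · have hnn : ∀ r : ℝ, 0 ≤ r⁻¹ * b r := by
      intro r
      by_cases h : b r = 0
      · simp [h]
      · have := (hbs h).1
        exact mul_nonneg (inv_nonneg.2 (by linarith)) b.nonneg
    have hcont : Continuous fun r : ℝ => r⁻¹ * b r := by
      refine continuous_iff_continuousAt.2 fun r => ?_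
      by_cases hr : r = 0
      · subst hr
        refine (continuousAt_const (y := (0 : ℝ))).congr ?_
        filter_upwards [Iio_mem_nhds (zero_lt_one' ℝ)] with y hy
        have : b y = 0 := by
          by_contra h
          have := (hbs h).1
          simp at hy
          linarith
        simp [this]
      · exact (continuousAt_inv₀ hr).mul b.continuous.continuousAt
    refine hcont.integral_pos_of_hasCompactSupport_nonneg_nonzero
      b.hasCompactSupport.mul_left hnn (x := 2) ?_
    rw [b.one_of_mem_closedBall (mem_closedBall_self b.rIn_pos.le)]
    norm_num
  · intro x hx
    have : b x = 0 := by
      by_contra h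
      have := (hbs h).1
      simp at hx
      linarith
    simp [this]

theorem exists_bounds_of_homogeneous {n : ℕ} {P : Euc n → ℝ}
    (hP1 : ContDiffOn ℝ 1 P {(0 : Euc n)}ᶜ)
    (hP : ∀ c : ℝ, 0 < c → ∀ x : Euc n, x ≠ 0 → P (c • x) = (c ^ n)⁻¹ * P x) :
    ∃ C : ℝ, 0 ≤ C ∧ (∀ x, x ≠ 0 → |P x| ≤ C / ‖x‖ ^ n) ∧
      ∀ x y, x ≠ 0 → 2 * ‖x - y‖ ≤ ‖x‖ → |P x - P y| ≤ C * ‖x - y‖ / ‖x‖ ^ (n + 1) := by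
  set K : Set (Euc n) := (fun x : Euc n => ‖x‖) ⁻¹' Icc (1 / 2) (3 / 2)
  have hK : IsCompact K := by
    refine (isCompact_closedBall (0 : Euc n) (3 / 2)).of_isClosed_subset
      (isClosed_Icc.preimage continuous_norm) fun x hx => by simpa using hx.2
  have hK0 : K ⊆ {(0 : Euc n)}ᶜ := by
    rintro x hx rfl
    have := hx.1
    norm_num at this
  obtain ⟨C₁, hC₁⟩ := hK.exists_bound_of_continuousOn (hP1.continuousOn.mono hK0)
  obtain ⟨C₂, hC₂⟩ := hK.exists_bound_of_continuousOn
    ((hP1.continuousOn_fderiv_of_isOpen isOpen_compl_singleton le_rfl).mono hK0)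
  have hscale : ∀ x : Euc n, x ≠ 0 → ∀ y : Euc n, y ≠ 0 →
      P y = (‖x‖ ^ n)⁻¹ * P (‖x‖⁻¹ • y) := by
    intro x hx y hy
    have hx' : 0 < ‖x‖ := norm_pos_iff.2 hx
    rw [← hP ‖x‖ hx' _ (by simp [hx, hy]), smul_smul, mul_inv_cancel₀ hx'.ne', one_smul]
  refine ⟨max (max C₁ C₂) 0, le_max_right _ _, fun x hx => ?_, fun x y hx hxy => ?_⟩
  · have hx' : 0 < ‖x‖ := norm_pos_iff.2 hx
    have hu : ‖x‖⁻¹ • x ∈ K := by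
      simp only [K, mem_preimage, norm_smul, norm_inv, norm_norm, inv_mul_cancel₀ hx'.ne']
      norm_num
    rw [hscale x hx x hx, abs_mul, abs_of_pos (by positivity), div_eq_inv_mul]
    gcongr
    exact (hC₁ _ hu).trans ((le_max_left _ _).trans (le_max_left _ _))
  · have hx' : 0 < ‖x‖ := norm_pos_iff.2 hx
    have hy : y ≠ 0 := by
      rintro rfl
      rw [sub_zero] at hxy
      linarith
    have hball : closedBall (‖x‖⁻¹ • x) (1 / 2) ⊆ K := by
      intro z hz
      have hn : ‖(‖x‖⁻¹ • x)‖ = 1 := by simp [norm_smul, hx]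
      rw [mem_closedBall, dist_eq_norm] at hz
      have h1 := norm_sub_norm_le (‖x‖⁻¹ • x) z
      have h2 := norm_sub_norm_le z (‖x‖⁻¹ • x)
      rw [norm_sub_rev] at h1
      constructor <;> linarith
    have hd : ‖‖x‖⁻¹ • x - ‖x‖⁻¹ • y‖ = ‖x - y‖ / ‖x‖ := by
      rw [← smul_sub, norm_smul, norm_inv, norm_norm, div_eq_inv_mul]
    have hyb : ‖x‖⁻¹ • y ∈ closedBall (‖x‖⁻¹ • x) (1 / 2) := by
      rw [mem_closedBall', dist_eq_norm, hd, div_le_iff₀ hx']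
      linarith
    have hmv := (convex_closedBall (‖x‖⁻¹ • x) (1 / 2)).norm_image_sub_le_of_norm_fderiv_le
      (𝕜 := ℝ) (f := P)
      (fun z hz => (hP1.contDiffAt (isOpen_compl_singleton.mem_nhds
        (hK0 (hball hz)))).differentiableAt one_ne_zero) (fun z hz => hC₂ z (hball hz))
      hyb (mem_closedBall_self (by norm_num))
    rw [hd, Real.norm_eq_abs] at hmv
    rw [hscale x hx x hx, hscale x hx y hy, ← mul_sub, abs_mul, abs_of_pos (by positivity)]
    calc _ ≤ (‖x‖ ^ n)⁻¹ * (C₂ * (‖x - y‖ / ‖x‖)) := by gcongr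
      _ ≤ (‖x‖ ^ n)⁻¹ * (max (max C₁ C₂) 0 * (‖x - y‖ / ‖x‖)) := by
        gcongr
        exact (le_max_right _ _).trans (le_max_left _ _)
      _ = _ := by rw [pow_succ]; field_simp

/-- The kernel truncated to the complement of the closed ball of radius `δ`. -/
def truncKernel {n : ℕ} (P : Euc n → ℝ) (δ : ℝ) (w : Euc n) : ℝ :=
  {w : Euc n | δ < ‖w‖}.indicator P w

/-- A kernel of degree `-n` with mean zero on spheres and the standard size and smoothness
estimates. -/
structure IsSingularKernel {n : ℕ} (P : Euc n → ℝ) (C : ℝ) : Prop where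
  continuousOn : ContinuousOn P {(0 : Euc n)}ᶜ
  nonneg : 0 ≤ C
  size : ∀ x, x ≠ 0 → |P x| ≤ C / ‖x‖ ^ n
  smooth : ∀ x y, x ≠ 0 → 2 * ‖x - y‖ ≤ ‖x‖ → |P x - P y| ≤ C * ‖x - y‖ / ‖x‖ ^ (n + 1)
  mean_zero : ∀ ψ : ℝ → ℝ, ∫ x, P x * ψ ‖x‖ = 0

namespace IsSingularKernel

variable {n : ℕ} {P : Euc n → ℝ} {C : ℝ}

theorem measurable_truncKernel (h : IsSingularKernel P C) {δ : ℝ} (hδ : 0 < δ) :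
    Measurable (truncKernel P δ) := by
  have hs : MeasurableSet {w : Euc n | δ < ‖w‖} := measurableSet_lt measurable_const measurable_norm
  refine measurable_of_restrict_of_restrict_compl hs ?_ ?_
  · have : {w : Euc n | δ < ‖w‖}.domRestrict (truncKernel P δ) =
        {w : Euc n | δ < ‖w‖}.domRestrict P := by
      ext x
      simp [truncKernel]
    rw [this]
    refine (continuousOn_iff_continuous_domRestrict.1 (h.continuousOn.mono ?_)).measurable
    rintro x hx rfl
    simp at hx
    linarith
  · have : {w : Euc n | δ < ‖w‖}ᶜ.domRestrict (truncKernel P δ) = fun _ => 0 := by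
      ext x
      simp only [truncKernel, Set.domRestrict_apply]
      exact Set.indicator_of_notMem x.2 _
    rw [this]
    exact measurable_const

theorem abs_truncKernel_le (h : IsSingularKernel P C) {δ : ℝ} (hδ : 0 < δ) (w : Euc n) :
    |truncKernel P δ w| ≤ C / δ ^ n := by
  have hC := h.nonneg
  by_cases hw : δ < ‖w‖
  · have hw0 : w ≠ 0 := norm_pos_iff.1 (hδ.trans hw)
    rw [truncKernel, Set.indicator_of_mem (by exact hw)]
    exact (h.size w hw0).trans (by gcongr)
  · rw [truncKernel, Set.indicator_of_notMem (by exact hw)]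
    simp only [abs_zero]
    positivity

theorem integrable_truncKernel_mul (h : IsSingularKernel P C) {δ : ℝ} (hδ : 0 < δ) (x : Euc n)
    {f : Euc n → ℝ} (hf : Integrable f) : Integrable fun y => truncKernel P δ (x - y) * f y := by
  refine hf.bdd_mul (c := C / δ ^ n)
    ((h.measurable_truncKernel hδ).comp (measurable_const.sub measurable_id)).aestronglyMeasurable
    (Filter.Eventually.of_forall fun y => h.abs_truncKernel_le hδ _)

/-- Truncations at comparable scales differ by at most a multiple of `ρ ^ γ`. -/
theorem abs_integral_trunc_sub_le (h : IsSingularKernel P C) {γ : ℝ} {δ ρ : ℝ}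
    (hδ : 0 < δ) (hδρ : δ ≤ ρ) {f : Euc n → ℝ} (hf : Integrable f) {H : ℝ} (x : Euc n)
    (hH : ∀ y, |f x - f y| ≤ H * ‖x - y‖ ^ γ)
    (hint : IntegrableOn (fun w : Euc n => ‖w‖ ^ γ / ‖w‖ ^ n) (closedBall 0 ρ)) :
    |(∫ y, truncKernel P δ (x - y) * f y) - ∫ y, truncKernel P ρ (x - y) * f y| ≤
      C * H * ∫ w in closedBall (0 : Euc n) ρ, ‖w‖ ^ γ / ‖w‖ ^ n := by
  have hρ : 0 < ρ := hδ.trans_le hδρ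
  have hC := h.nonneg
  set D : Euc n → ℝ := fun w => truncKernel P δ w - truncKernel P ρ w
  have hD : ∀ w, D w = P w * (Ioc δ ρ).indicator (fun _ => (1 : ℝ)) ‖w‖ := by
    intro w
    simp only [D, truncKernel, Set.indicator, mem_ofPred_eq, mem_Ioc]
    split_ifs <;> grind
  have hDm : Measurable D := (h.measurable_truncKernel hδ).sub (h.measurable_truncKernel hρ)
  have hD0 : ∫ y, D (x - y) = 0 := by
    rw [integral_sub_left_eq_self D volume x]
    simp_rw [hD]
    exact h.mean_zero _
  have hDb : ∀ w, |D w| ≤ (closedBall (0 : Euc n) ρ).indicator (fun w => C / ‖w‖ ^ n) w := by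
    intro w
    rw [hD]
    by_cases hw : ‖w‖ ∈ Ioc δ ρ
    · rw [Set.indicator_of_mem hw, Set.indicator_of_mem (by simpa using hw.2), mul_one]
      exact h.size w (norm_pos_iff.1 (hδ.trans hw.1))
    · rw [Set.indicator_of_notMem hw, mul_zero, abs_zero]
      exact Set.indicator_nonneg (fun _ _ => by positivity) _
  have hDi : Integrable fun y => D (x - y) := by
    have h1 : Integrable D := by
      refine Measure.integrableOn_of_bounded (s := closedBall (0 : Euc n) ρ)
        (M := C / δ ^ n + C / ρ ^ n) ?_ hDm.aestronglyMeasurable ?_ |>.integrable_of_forall_notMem_eq_zero ?_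
      · exact measure_closedBall_lt_top.ne
      · refine Filter.Eventually.of_forall fun w => ?_
        exact (norm_sub_le _ _).trans
          (add_le_add (h.abs_truncKernel_le hδ _) (h.abs_truncKernel_le hρ _))
      · intro w hw
        have := hDb w
        rw [Set.indicator_of_notMem hw] at this
        exact abs_nonpos_iff.1 this
    exact h1.comp_sub_left x
  have hDf : Integrable fun y => D (x - y) * f y := by
    simp only [D, sub_mul]
    exact (h.integrable_truncKernel_mul hδ x hf).sub (h.integrable_truncKernel_mul hρ x hf)
  have he : (∫ y, truncKernel P δ (x - y) * f y) - ∫ y, truncKernel P ρ (x - y) * f y =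
      ∫ y, D (x - y) * (f y - f x) := by
    rw [← integral_sub (h.integrable_truncKernel_mul hδ x hf)
      (h.integrable_truncKernel_mul hρ x hf)]
    simp_rw [mul_sub]
    rw [integral_sub hDf (hDi.mul_const _), integral_mul_const, hD0, zero_mul, sub_zero]
    simp only [D, sub_mul]
  set B : Euc n → ℝ := (closedBall (0 : Euc n) ρ).indicator fun w => ‖w‖ ^ γ / ‖w‖ ^ n
  have hB : Integrable B := (integrable_indicator_iff measurableSet_closedBall).2 hint
  rw [he, ← integral_indicator measurableSet_closedBall, ← integral_sub_left_eq_self B volume x,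
    ← integral_const_mul, ← Real.norm_eq_abs]
  refine norm_integral_le_of_norm_le ((hB.comp_sub_left x).const_mul (C * H))
    (Filter.Eventually.of_forall fun y => ?_)
  rw [norm_mul, Real.norm_eq_abs, Real.norm_eq_abs, abs_sub_comm (f y)]
  calc _ ≤ (closedBall (0 : Euc n) ρ).indicator (fun w => C / ‖w‖ ^ n) (x - y) *
        (H * ‖x - y‖ ^ γ) := by
        gcongr
        · exact (abs_nonneg _).trans (hDb _)
        · exact hDb _
        · exact hH y
    _ = C * H * B (x - y) := by
      simp only [B, Set.indicator]
      split_ifs <;> ring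

theorem abs_truncKernel_sub_le (h : IsSingularKernel P C) {r : ℝ} (hr : 0 < r) {w v : Euc n}
    (hv : ‖v‖ = r) : |truncKernel P (2 * r) w - truncKernel P (2 * r) (w - v)| ≤
      C * (2 ^ (n + 1) + 2 * 4 ^ (n + 1)) * (r / (r + ‖w‖) ^ (n + 1)) := by
  have hC := h.nonneg
  have hw0 := norm_nonneg w
  by_cases hw : 3 * r < ‖w‖
  · have hwv : 2 * r < ‖w - v‖ := by linarith [norm_sub_norm_le w v]
    rw [truncKernel, truncKernel, Set.indicator_of_mem (by simpa using by linarith),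
      Set.indicator_of_mem (by exact hwv)]
    have hs := h.smooth w (w - v) (norm_pos_iff.1 (by linarith))
      (by rw [_root_.sub_sub_cancel, hv]; linarith)
    rw [_root_.sub_sub_cancel, hv] at hs
    calc _ ≤ C * r / ‖w‖ ^ (n + 1) := hs
      _ ≤ C * r / ((r + ‖w‖) / 2) ^ (n + 1) := by
        gcongr
        linarith
      _ = C * 2 ^ (n + 1) * (r / (r + ‖w‖) ^ (n + 1)) := by
        rw [div_pow]; field_simp
      _ ≤ _ := by
        gcongr
        exact le_add_of_nonneg_right (by positivity)
  · push Not at hw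
    have hr2 : 0 < 2 * r := by linarith
    calc _ ≤ C / (2 * r) ^ n + C / (2 * r) ^ n :=
        (abs_sub _ _).trans (add_le_add (h.abs_truncKernel_le hr2 _) (h.abs_truncKernel_le hr2 _))
      _ ≤ C / r ^ n + C / r ^ n := by
        gcongr <;> linarith
      _ = C * (2 * 4 ^ (n + 1)) * (r / (4 * r) ^ (n + 1)) := by
        rw [mul_pow, pow_succ r]; field_simp; norm_num
      _ ≤ C * (2 ^ (n + 1) + 2 * 4 ^ (n + 1)) * (r / (r + ‖w‖) ^ (n + 1)) := by
        gcongr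
        · exact le_add_of_nonneg_left (by positivity)
        · linarith

end IsSingularKernel

section RadialIntegrals

variable {n : ℕ} {γ : ℝ}

theorem tail_eq_scaled {r : ℝ} (hr : 0 < r) (w : Euc n) :
    r / (r + ‖w‖) ^ (n + 1) * ‖w‖ ^ γ =
      r ^ γ / r ^ n * (1 / (1 + ‖r⁻¹ • w‖) ^ (n + 1) * ‖r⁻¹ • w‖ ^ γ) := by
  have h1 : 1 + ‖r⁻¹ • w‖ = (r + ‖w‖) / r := by
    rw [norm_smul, norm_inv, Real.norm_of_nonneg hr.le]; field_simp
  have h2 : ‖r⁻¹ • w‖ ^ γ = ‖w‖ ^ γ / r ^ γ := by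
    rw [norm_smul, norm_inv, Real.norm_of_nonneg hr.le, ← div_eq_inv_mul,
      Real.div_rpow (norm_nonneg _) hr.le]
  rw [h1, h2, div_pow, pow_succ r]
  have := norm_nonneg w
  have : r ^ γ ≠ 0 := (Real.rpow_pos_of_pos hr γ).ne'
  field_simp

theorem integrable_unit_tail (h0 : 0 ≤ γ) (h1 : γ < 1) :
    Integrable fun w : Euc n => 1 / (1 + ‖w‖) ^ (n + 1) * ‖w‖ ^ γ := by
  have hi : Integrable fun w : Euc n => (1 + ‖w‖) ^ (-((n : ℝ) + 1 - γ)) :=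
    integrable_one_add_norm (by rw [finrank_euclideanSpace_fin]; linarith)
  refine hi.mono' (by fun_prop) (Filter.Eventually.of_forall fun w => ?_)
  have hw := norm_nonneg w
  have hpos : 0 < 1 + ‖w‖ := by linarith
  rw [Real.norm_of_nonneg (by positivity), neg_sub, Real.rpow_sub hpos, div_eq_inv_mul,
    mul_one]
  have : (1 + ‖w‖) ^ ((n : ℝ) + 1) = (1 + ‖w‖) ^ (n + 1) := by
    rw [← Real.rpow_natCast]; norm_num
  rw [this, div_eq_inv_mul]
  gcongr
  linarith

theorem integrable_tail (h0 : 0 ≤ γ) (h1 : γ < 1) {r : ℝ} (hr : 0 < r) :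
    Integrable fun w : Euc n => r / (r + ‖w‖) ^ (n + 1) * ‖w‖ ^ γ := by
  simp_rw [tail_eq_scaled hr]
  exact ((integrable_unit_tail h0 h1).comp_smul (inv_ne_zero hr.ne')).const_mul _

theorem integral_tail {r : ℝ} (hr : 0 < r) :
    ∫ w : Euc n, r / (r + ‖w‖) ^ (n + 1) * ‖w‖ ^ γ =
      r ^ γ * ∫ w : Euc n, 1 / (1 + ‖w‖) ^ (n + 1) * ‖w‖ ^ γ := by
  simp_rw [tail_eq_scaled hr]
  rw [integral_const_mul, Measure.integral_comp_inv_smul_of_nonneg volume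
    (fun w : Euc n => 1 / (1 + ‖w‖) ^ (n + 1) * ‖w‖ ^ γ) hr.le, finrank_euclideanSpace_fin,
    smul_eq_mul]
  field_simp

theorem local_eq_scaled {r : ℝ} (hr : 0 < r) (w : Euc n) :
    (closedBall (0 : Euc n) r).indicator (fun w => ‖w‖ ^ γ / ‖w‖ ^ n) w = r ^ γ / r ^ n *
      (closedBall (0 : Euc n) 1).indicator (fun w => ‖w‖ ^ γ / ‖w‖ ^ n) (r⁻¹ • w) := by
  have h2 : ‖r⁻¹ • w‖ = ‖w‖ / r := by
    rw [norm_smul, norm_inv, Real.norm_of_nonneg hr.le, ← div_eq_inv_mul]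
  simp only [Set.indicator, mem_closedBall_zero_iff, h2, div_le_one hr]
  split_ifs
  · rw [Real.div_rpow (norm_nonneg _) hr.le, div_pow]
    have : r ^ γ ≠ 0 := (Real.rpow_pos_of_pos hr γ).ne'
    field_simp
  · simp

theorem integrableOn_unit_local [NeZero n] (h0 : 0 < γ) :
    IntegrableOn (fun w : Euc n => ‖w‖ ^ γ / ‖w‖ ^ n) (closedBall 0 1) := by
  have : Nontrivial (Euc n) := by
    have : Nonempty (Fin n) := ⟨0⟩
    infer_instance
  refine IntegrableOn.mono_set (t := ball (0 : Euc n) 2) ?_ (closedBall_subset_ball (by norm_num))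
  refine (integrableOn_fun_norm_addHaar volume (f := fun y : ℝ => y ^ γ / y ^ n)).2 ?_
  have h := (intervalIntegral.intervalIntegrable_rpow' (a := 0) (b := 2)
    (show -1 < γ - 1 by linarith)).1.mono_set Ioo_subset_Ioc_self
  refine h.congr_fun (fun y hy => ?_) measurableSet_Ioo
  have hy : 0 < y := hy.1
  have hn : y ^ n = y ^ (n - 1) * y := by rw [← pow_succ, Nat.sub_add_cancel NeZero.one_le]
  simp only [finrank_euclideanSpace_fin, smul_eq_mul, hn, Real.rpow_sub hy, Real.rpow_one]
  field_simp

theorem integrableOn_local [NeZero n] (h0 : 0 < γ) {r : ℝ} (hr : 0 < r) :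
    IntegrableOn (fun w : Euc n => ‖w‖ ^ γ / ‖w‖ ^ n) (closedBall 0 r) := by
  rw [← integrable_indicator_iff measurableSet_closedBall, funext (local_eq_scaled hr)]
  exact (((integrable_indicator_iff measurableSet_closedBall).2
    (integrableOn_unit_local h0)).comp_smul (inv_ne_zero hr.ne')).const_mul _

theorem integral_local {r : ℝ} (hr : 0 < r) :
    ∫ w in closedBall (0 : Euc n) r, ‖w‖ ^ γ / ‖w‖ ^ n =
      r ^ γ * ∫ w in closedBall (0 : Euc n) 1, ‖w‖ ^ γ / ‖w‖ ^ n := by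
  rw [← integral_indicator measurableSet_closedBall, ← integral_indicator measurableSet_closedBall,
    funext (local_eq_scaled hr), integral_const_mul, Measure.integral_comp_inv_smul_of_nonneg
    volume _ hr.le, finrank_euclideanSpace_fin, smul_eq_mul]
  field_simp

end RadialIntegrals

namespace IsSingularKernel

variable {n : ℕ} {P : Euc n → ℝ} {C : ℝ}

theorem integrable_truncKernel_sub (h : IsSingularKernel P C) {x₁ x₂ : Euc n} (hx : x₁ ≠ x₂) :
    Integrable fun z => truncKernel P (2 * ‖x₁ - x₂‖) (x₁ - z) -
      truncKernel P (2 * ‖x₁ - x₂‖) (x₂ - z) := by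
  have hr : 0 < ‖x₁ - x₂‖ := norm_pos_iff.2 (sub_ne_zero.2 hx)
  have hm := h.measurable_truncKernel (δ := 2 * ‖x₁ - x₂‖) (by linarith)
  have hi := ((integrable_tail (n := n) le_rfl one_pos hr).comp_sub_left x₁).const_mul
    (C * (2 ^ (n + 1) + 2 * 4 ^ (n + 1)))
  refine hi.mono' ((hm.comp (measurable_const.sub measurable_id)).sub
    (hm.comp (measurable_const.sub measurable_id))).aestronglyMeasurable
    (Filter.Eventually.of_forall fun z => ?_)
  have := h.abs_truncKernel_sub_le hr (w := x₁ - z) (v := x₁ - x₂) rfl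
  rw [_root_.sub_sub_sub_cancel_left] at this
  simpa using this

/-- The Lipschitz radial cutoff equal to `1` on `[0, R]` and to `0` on `[2 R, ∞)`. -/
def radialCutoff (R t : ℝ) : ℝ := max 0 (min 1 (2 - t / R))

theorem radialCutoff_eq_one {R t : ℝ} (hR : 0 < R) (ht : t ≤ R) : radialCutoff R t = 1 := by
  have : t / R ≤ 1 := (div_le_one hR).2 ht
  rw [radialCutoff, min_eq_left (by linarith), max_eq_right zero_le_one]

theorem radialCutoff_eq_zero {R t : ℝ} (hR : 0 < R) (ht : 2 * R ≤ t) : radialCutoff R t = 0 := by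
  have : 2 ≤ t / R := (le_div_iff₀ hR).2 ht
  rw [radialCutoff, max_eq_left ((min_le_right _ _).trans (by linarith))]

theorem radialCutoff_mem (R t : ℝ) : radialCutoff R t ∈ Icc (0 : ℝ) 1 :=
  ⟨le_max_left _ _, max_le zero_le_one (min_le_left _ _)⟩

theorem abs_radialCutoff_sub_le {R : ℝ} (hR : 0 < R) (s t : ℝ) :
    |radialCutoff R s - radialCutoff R t| ≤ |s - t| / R := by
  unfold radialCutoff
  calc _ ≤ |min 1 (2 - s / R) - min 1 (2 - t / R)| := by
        simpa [max_comm] using abs_max_sub_max_le_abs (min 1 (2 - s / R)) (min 1 (2 - t / R)) 0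
    _ ≤ |(2 - s / R) - (2 - t / R)| := by
        have := abs_min_sub_min_le_max 1 (2 - s / R) 1 (2 - t / R)
        simpa using this
    _ = _ := by
        rw [_root_.sub_sub_sub_cancel_left, ← sub_div, abs_div, abs_of_pos hR, abs_sub_comm]

theorem continuous_radialCutoff (R : ℝ) : Continuous (radialCutoff R) := by
  unfold radialCutoff
  fun_prop

theorem integrable_radialCutoff {R : ℝ} (hR : 0 < R) (x : Euc n) :
    Integrable fun z => radialCutoff R ‖x - z‖ := by
  have h : Integrable fun w : Euc n => radialCutoff R ‖w‖ := by
    refine ((continuous_radialCutoff R).comp continuous_norm).integrable_of_hasCompactSupport ?_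
    refine HasCompactSupport.intro (isCompact_closedBall 0 (2 * R)) fun w hw => ?_
    exact radialCutoff_eq_zero hR (by simpa using (not_le.1 (by simpa using hw)).le)
  exact h.comp_sub_left x

theorem integral_truncKernel_mul_radial (h : IsSingularKernel P C) (δ : ℝ) (ψ : ℝ → ℝ)
    (x : Euc n) : ∫ z, truncKernel P δ (x - z) * ψ ‖x - z‖ = 0 := by
  rw [integral_sub_left_eq_self (fun w => truncKernel P δ w * ψ ‖w‖) volume x,
    ← h.mean_zero ((Ioi δ).indicator ψ)]
  congr 1 with w
  simp only [truncKernel, Set.indicator, mem_ofPred_eq, mem_Ioi]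
  split_ifs <;> simp

theorem abs_integral_truncKernel_sub_mul_cutoff_le (h : IsSingularKernel P C) {x₁ x₂ : Euc n}
    {δ R : ℝ} (hδ : 0 < δ) (hR : 0 < R) (hxR : 2 * ‖x₁ - x₂‖ ≤ R) :
    |∫ z, (truncKernel P δ (x₁ - z) - truncKernel P δ (x₂ - z)) * radialCutoff R ‖x₁ - z‖| ≤
      C * 6 ^ n * ‖x₁ - x₂‖ * volume.real (ball (0 : Euc n) 1) / R := by
  have hC := h.nonneg
  have hi := fun (x y : Euc n) =>
    h.integrable_truncKernel_mul hδ x (integrable_radialCutoff hR y)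
  have he : ∫ z, (truncKernel P δ (x₁ - z) - truncKernel P δ (x₂ - z)) * radialCutoff R ‖x₁ - z‖ =
      ∫ z, truncKernel P δ (x₂ - z) * (radialCutoff R ‖x₂ - z‖ - radialCutoff R ‖x₁ - z‖) := by
    simp_rw [sub_mul, mul_sub]
    rw [integral_sub (hi _ _) (hi _ _), integral_sub (hi _ _) (hi _ _),
      h.integral_truncKernel_mul_radial, h.integral_truncKernel_mul_radial]
  have hd : ∀ z, |‖x₂ - z‖ - ‖x₁ - z‖| ≤ ‖x₁ - x₂‖ := fun z => by
    have := abs_norm_sub_norm_le (x₂ - z) (x₁ - z)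
    rwa [sub_sub_sub_cancel_right, norm_sub_rev x₂ x₁] at this
  have hb : ∀ z, ‖truncKernel P δ (x₂ - z) *
      (radialCutoff R ‖x₂ - z‖ - radialCutoff R ‖x₁ - z‖)‖ ≤
      C / (R / 2) ^ n * (‖x₁ - x₂‖ / R) := by
    intro z
    by_cases hz : ‖x₂ - z‖ < R / 2
    · have := abs_le.1 (hd z)
      rw [radialCutoff_eq_one hR (by linarith), radialCutoff_eq_one hR (by linarith), sub_self,
        mul_zero, norm_zero]
      positivity
    · push Not at hz
      rw [norm_mul, Real.norm_eq_abs, Real.norm_eq_abs]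
      have h1 : |truncKernel P δ (x₂ - z)| ≤ C / (R / 2) ^ n := by
        by_cases hm : δ < ‖x₂ - z‖
        · rw [truncKernel, Set.indicator_of_mem (by exact hm)]
          refine (h.size _ (norm_pos_iff.1 (hδ.trans hm))).trans ?_
          gcongr
        · rw [truncKernel, Set.indicator_of_notMem (by exact hm), abs_zero]
          positivity
      have h2 := (abs_radialCutoff_sub_le hR ‖x₂ - z‖ ‖x₁ - z‖).trans
        (div_le_div_of_nonneg_right (hd z) hR.le)
      gcongr
  have hs : ∀ z, z ∉ closedBall x₂ (3 * R) → truncKernel P δ (x₂ - z) *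
      (radialCutoff R ‖x₂ - z‖ - radialCutoff R ‖x₁ - z‖) = 0 := by
    intro z hz
    rw [mem_closedBall', dist_eq_norm, not_le] at hz
    have := abs_le.1 (hd z)
    rw [radialCutoff_eq_zero hR (by linarith), radialCutoff_eq_zero hR (by linarith), sub_self,
      mul_zero]
  rw [he, ← setIntegral_eq_integral_of_forall_compl_eq_zero hs, ← Real.norm_eq_abs]
  refine (norm_setIntegral_le_of_norm_le_const measure_closedBall_lt_top
    fun z _ => hb z).trans_eq ?_
  rw [Measure.addHaar_real_closedBall _ _ (by positivity), finrank_euclideanSpace_fin,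
    show (6 : ℝ) = 3 * 2 by norm_num, mul_pow, mul_pow, div_pow]
  field_simp

theorem integral_truncKernel_sub_eq_zero (h : IsSingularKernel P C) {x₁ x₂ : Euc n}
    (hx : x₁ ≠ x₂) :
    ∫ z, (truncKernel P (2 * ‖x₁ - x₂‖) (x₁ - z) - truncKernel P (2 * ‖x₁ - x₂‖) (x₂ - z)) = 0 := by
  have hr : 0 < ‖x₁ - x₂‖ := norm_pos_iff.2 (sub_ne_zero.2 hx)
  have hi := h.integrable_truncKernel_sub hx
  set g : Euc n → ℝ := fun z =>
    truncKernel P (2 * ‖x₁ - x₂‖) (x₁ - z) - truncKernel P (2 * ‖x₁ - x₂‖) (x₂ - z)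
  have hlim : Filter.Tendsto (fun R : ℝ => ∫ z, g z * radialCutoff R ‖x₁ - z‖) Filter.atTop
      (nhds (∫ z, g z)) := by
    refine tendsto_integral_filter_of_dominated_convergence (fun z => ‖g z‖)
      (Filter.Eventually.of_forall fun R => hi.aestronglyMeasurable.mul ?_)
      (Filter.Eventually.of_forall fun R => Filter.Eventually.of_forall fun z => ?_) hi.norm
      (Filter.Eventually.of_forall fun z => ?_)
    · exact ((continuous_radialCutoff R).comp (by fun_prop)).aestronglyMeasurable
    · rw [norm_mul]
      refine mul_le_of_le_one_right (norm_nonneg _) ?_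
      rw [Real.norm_of_nonneg (radialCutoff_mem _ _).1]
      exact (radialCutoff_mem _ _).2
    · refine (tendsto_const_nhds (x := g z)).congr' ?_
      filter_upwards [Filter.eventually_ge_atTop ‖x₁ - z‖, Filter.eventually_gt_atTop 0]
        with R hR hR0
      rw [radialCutoff_eq_one hR0 hR, mul_one]
  refine tendsto_nhds_unique hlim (squeeze_zero_norm' ?_
    (Filter.Tendsto.div_atTop (tendsto_const_nhds (x :=
      C * 6 ^ n * ‖x₁ - x₂‖ * volume.real (ball (0 : Euc n) 1))) Filter.tendsto_id))
  filter_upwards [Filter.eventually_ge_atTop (2 * ‖x₁ - x₂‖)] with R hR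
  exact h.abs_integral_truncKernel_sub_mul_cutoff_le (by linarith) (by linarith) hR

/-- Hölder estimate for the operator truncated at the scale of the increment. -/
theorem abs_integral_trunc_increment_le (h : IsSingularKernel P C) {γ : ℝ} (h0 : 0 ≤ γ)
    (h1 : γ < 1) {f : Euc n → ℝ} (hf : Integrable f) {H : ℝ} {x₁ x₂ : Euc n} (hx : x₁ ≠ x₂)
    (hH : ∀ y, |f x₁ - f y| ≤ H * ‖x₁ - y‖ ^ γ) :
    |(∫ z, truncKernel P (2 * ‖x₁ - x₂‖) (x₁ - z) * f z) -
        ∫ z, truncKernel P (2 * ‖x₁ - x₂‖) (x₂ - z) * f z| ≤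
      C * (2 ^ (n + 1) + 2 * 4 ^ (n + 1)) * H *
        (‖x₁ - x₂‖ ^ γ * ∫ w : Euc n, 1 / (1 + ‖w‖) ^ (n + 1) * ‖w‖ ^ γ) := by
  have hC := h.nonneg
  have hr : 0 < ‖x₁ - x₂‖ := norm_pos_iff.2 (sub_ne_zero.2 hx)
  have hr2 : 0 < 2 * ‖x₁ - x₂‖ := by linarith
  have hi := h.integrable_truncKernel_sub hx
  have hz := h.integral_truncKernel_sub_eq_zero hx
  set g : Euc n → ℝ := fun z =>
    truncKernel P (2 * ‖x₁ - x₂‖) (x₁ - z) - truncKernel P (2 * ‖x₁ - x₂‖) (x₂ - z) with hg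
  have hgf : Integrable fun z => g z * f z := by
    simp only [hg, sub_mul]
    exact (h.integrable_truncKernel_mul hr2 x₁ hf).sub (h.integrable_truncKernel_mul hr2 x₂ hf)
  have he : (∫ z, truncKernel P (2 * ‖x₁ - x₂‖) (x₁ - z) * f z) -
      ∫ z, truncKernel P (2 * ‖x₁ - x₂‖) (x₂ - z) * f z = ∫ z, g z * (f z - f x₁) := by
    rw [← integral_sub (h.integrable_truncKernel_mul hr2 x₁ hf)
      (h.integrable_truncKernel_mul hr2 x₂ hf)]
    simp_rw [mul_sub]
    rw [integral_sub hgf (hi.mul_const _), integral_mul_const, hz, zero_mul, sub_zero]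
    simp only [hg, sub_mul]
  set T : Euc n → ℝ := fun w => ‖x₁ - x₂‖ / (‖x₁ - x₂‖ + ‖w‖) ^ (n + 1) * ‖w‖ ^ γ with hT
  have hTi : Integrable T := integrable_tail h0 h1 hr
  rw [he, ← integral_tail hr, ← integral_sub_left_eq_self T volume x₁, ← integral_const_mul,
    ← Real.norm_eq_abs]
  refine norm_integral_le_of_norm_le ((hTi.comp_sub_left x₁).const_mul _)
    (Filter.Eventually.of_forall fun z => ?_)
  have hgz : |g z| ≤ C * (2 ^ (n + 1) + 2 * 4 ^ (n + 1)) *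
      (‖x₁ - x₂‖ / (‖x₁ - x₂‖ + ‖x₁ - z‖) ^ (n + 1)) := by
    have := h.abs_truncKernel_sub_le hr (w := x₁ - z) (v := x₁ - x₂) rfl
    rwa [_root_.sub_sub_sub_cancel_left] at this
  rw [norm_mul, Real.norm_eq_abs, Real.norm_eq_abs, abs_sub_comm (f z)]
  calc _ ≤ C * (2 ^ (n + 1) + 2 * 4 ^ (n + 1)) *
      (‖x₁ - x₂‖ / (‖x₁ - x₂‖ + ‖x₁ - z‖) ^ (n + 1)) * (H * ‖x₁ - z‖ ^ γ) :=
        mul_le_mul hgz (hH z) (abs_nonneg _) ((abs_nonneg _).trans hgz)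
    _ = _ := by
      simp only [hT]
      ring

end IsSingularKernel

theorem isSingularKernel_pd {n : ℕ} {k : Euc n → ℝ} (hk : ContDiffOn ℝ 2 k {(0 : Euc n)}ᶜ)
    (hkh : Homog1n k) (i : Fin n) : ∃ C, IsSingularKernel (pd i k) C := by
  obtain ⟨C, hC, hsize, hsmooth⟩ := exists_bounds_of_homogeneous (contDiffOn_pd hk i)
    fun c hc x hx => pd_smul hkh i hc hx
  exact ⟨C, (contDiffOn_pd hk i).continuousOn, hC, hsize, hsmooth, integral_pd_mul_radial hk hkh i⟩

theorem abs_sub_le_of_hSemi_ne_top {n : ℕ} {γ : ℝ} (hγ : 0 < γ) {f : Euc n → ℝ}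
    (hf : hSemi γ f ≠ ⊤) (x y : Euc n) : |f x - f y| ≤ (hSemi γ f).toReal * ‖x - y‖ ^ γ := by
  by_cases hxy : x = y
  · simp [hxy, Real.zero_rpow hγ.ne']
  · have hpos : 0 < ‖x - y‖ ^ γ := Real.rpow_pos_of_pos (norm_pos_iff.2 (sub_ne_zero.2 hxy)) γ
    rw [← div_le_iff₀ hpos]
    refine (ENNReal.ofReal_le_iff_le_toReal hf).1 ?_
    exact le_iSup_of_le x (le_iSup_of_le y (le_iSup_of_le hxy le_rfl))

theorem continuous_of_abs_sub_le_rpow {n : ℕ} {γ H : ℝ} (hγ : 0 < γ) {f : Euc n → ℝ}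
    (hf : ∀ x y, |f x - f y| ≤ H * ‖x - y‖ ^ γ) : Continuous f := by
  refine continuous_iff_continuousAt.2 fun x => tendsto_iff_norm_sub_tendsto_zero.2 ?_
  refine squeeze_zero (fun _ => norm_nonneg _) (fun y => hf y x) ?_
  have h : Continuous fun y : Euc n => H * ‖y - x‖ ^ γ :=
    continuous_const.mul ((continuous_id.sub continuous_const).norm.rpow_const
      fun _ => Or.inr hγ.le)
  simpa [Real.zero_rpow hγ.ne'] using h.tendsto x

theorem stmt5 (n : ℕ) (γ : ℝ) (hγ0 : 0 < γ) (hγ1 : γ < 1)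
    (k : Euc n → ℝ) (hk : ContDiffOn ℝ 2 k {(0 : Euc n)}ᶜ) (hkh : Homog1n k) (i : Fin n) :
    ∃ c : ℝ, 0 < c ∧
      ∀ f : Euc n → ℝ, hNorm γ f ≠ ⊤ → HasCompactSupport f →
      ∀ S : Euc n → ℝ,
        (∀ x : Euc n, Filter.Tendsto
            (fun δ : ℝ => ∫ y in {y : Euc n | δ < ‖x - y‖}, pd i k (x - y) * f y)
            (nhdsWithin 0 (Set.Ioi 0)) (nhds (S x))) →
        hSemi γ S ≤ ENNReal.ofReal c * hSemi γ f := by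
  have : NeZero n := ⟨by rintro rfl; exact i.elim0⟩
  obtain ⟨C, hP⟩ := isSingularKernel_pd hk hkh i
  have hC := hP.nonneg
  set A := ∫ w in closedBall (0 : Euc n) 1, ‖w‖ ^ γ / ‖w‖ ^ n
  set B := ∫ w : Euc n, 1 / (1 + ‖w‖) ^ (n + 1) * ‖w‖ ^ γ
  have hA : 0 ≤ A := integral_nonneg fun w => by positivity
  have hB : 0 ≤ B := integral_nonneg fun w => by positivity
  have hc : 0 < 2 * (C * (2 ^ γ * A)) + C * (2 ^ (n + 1) + 2 * 4 ^ (n + 1)) * B + 1 := by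
    positivity
  refine ⟨_, hc, fun f hf hfc S hS => ?_⟩
  have hfs : hSemi γ f ≠ ⊤ := (ENNReal.add_ne_top.1 hf).2
  have hH := abs_sub_le_of_hSemi_ne_top hγ0 hfs
  have hfi : Integrable f :=
    (continuous_of_abs_sub_le_rpow hγ0 hH).integrable_of_hasCompactSupport hfc
  rw [← ENNReal.ofReal_toReal hfs, ← ENNReal.ofReal_mul hc.le]
  have hH0 : 0 ≤ (hSemi γ f).toReal := ENNReal.toReal_nonneg
  set H := (hSemi γ f).toReal
  have hS' : ∀ x, Filter.Tendsto (fun δ : ℝ => ∫ y, truncKernel (pd i k) δ (x - y) * f y)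
      (nhdsWithin 0 (Ioi 0)) (nhds (S x)) := by
    intro x
    refine (hS x).congr fun δ => ?_
    have hm : MeasurableSet {y : Euc n | δ < ‖x - y‖} :=
      measurableSet_lt measurable_const (by fun_prop)
    rw [← integral_indicator hm]
    congr 1 with y
    simp only [truncKernel, Set.indicator, mem_ofPred_eq]
    split_ifs <;> simp
  refine iSup_le fun x₁ => iSup_le fun x₂ => iSup_le fun hx => ENNReal.ofReal_le_ofReal ?_
  have hr : 0 < ‖x₁ - x₂‖ := norm_pos_iff.2 (sub_ne_zero.2 hx)
  have hr2 : 0 < 2 * ‖x₁ - x₂‖ := by linarith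
  have hrγ : 0 < ‖x₁ - x₂‖ ^ γ := Real.rpow_pos_of_pos hr γ
  have hnear : ∀ x, |S x - ∫ y, truncKernel (pd i k) (2 * ‖x₁ - x₂‖) (x - y) * f y| ≤
      C * H * ((2 * ‖x₁ - x₂‖) ^ γ * A) := by
    intro x
    refine le_of_tendsto ((hS' x).sub_const _).abs ?_
    filter_upwards [Ioc_mem_nhdsGT hr2] with δ hδ
    rw [← integral_local hr2]
    exact hP.abs_integral_trunc_sub_le hδ.1 hδ.2 hfi x (hH x) (integrableOn_local hγ0 hr2)
  have h1 := abs_le.1 (hnear x₁)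
  have h2 := abs_le.1 (hnear x₂)
  have h3 := abs_le.1 (hP.abs_integral_trunc_increment_le hγ0.le hγ1 hfi hx (hH x₁))
  rw [div_le_iff₀ hrγ]
  have hmain : |S x₁ - S x₂| ≤ 2 * (C * H * ((2 * ‖x₁ - x₂‖) ^ γ * A)) +
      C * (2 ^ (n + 1) + 2 * 4 ^ (n + 1)) * H * (‖x₁ - x₂‖ ^ γ * B) := by
    rw [abs_le]
    constructor <;> linarith
  rw [Real.mul_rpow zero_le_two hr.le] at hmain
  refine hmain.trans ?_
  have : 0 ≤ H * ‖x₁ - x₂‖ ^ γ := by positivity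
  linarith

end
end
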